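/- Let Λ₁, Λ₂ be two-sided subshifts over finite alphabets. The following are equivalent: (i) Λ₁ and Λ₂ are topologically conjugate; (ii) there exist an isomorphism φ : G_{Λ₁} → G_{Λ₂} of étale groupoids and a homeomorphism h_Λ : Λ₁ → Λ₂ such that φ(R_{Λ₁}) = R_{Λ₂} (where R_{Λ_i} is embedded in G_{Λ_i} as {(x,0,z) : (x,z) ∈ R_{Λ_i}}), h_Λ ∘ π₁ = π₂ ∘ h where h is the restriction of φ to the unit spaces (identified with the configuration spaces X_{Λ_i}) and π_i : X_{Λ_i} → Λ_i are the factor maps, and d_{Λ₂} ∘ φ = d_{Λ₁}, where d_{Λ_i}(x,n,z) = n. -/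

import Mathlib

/-! ## λ-graph bisystems -/

structure LambdaGraphBisystem (A : Type) where
  V : ℕ → Type
  Em : ℕ → Type
  Ep : ℕ → Type
  fintypeV : ∀ l, Fintype (V l)
  nonemptyV : ∀ l, Nonempty (V l)
  fintypeEm : ∀ l, Fintype (Em l)
  fintypeEp : ∀ l, Fintype (Ep l)
  sm : ∀ l, Em l → V (l + 1)
  tm : ∀ l, Em l → V l
  lm : ∀ l, Em l → A
  sp : ∀ l, Ep l → V l
  tp : ∀ l, Ep l → V (l + 1)
  lp : ∀ l, Ep l → A

namespace LambdaGraphBisystem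

variable {A : Type}

/-- The follower sets `F(v)`: label words of downward paths in `L⁻` starting at `v`,
labels read in reverse edge order. -/
def Fset (L : LambdaGraphBisystem A) : ∀ l, L.V l → Set (List A)
  | 0, _ => {[]}
  | l + 1, v =>
    {w | ∃ e : L.Em l, L.sm l e = v ∧ ∃ w' ∈ L.Fset l (L.tm l e), w = L.lm l e :: w'}

/-- The predecessor sets `P(v)`: label words of upward paths in `L⁺` ending at `v`. -/
def Pset (L : LambdaGraphBisystem A) : ∀ l, L.V l → Set (List A)
  | 0, _ => {[]}
  | l + 1, v =>
    {w | ∃ e : L.Ep l, L.tp l e = v ∧ ∃ w' ∈ L.Pset l (L.sp l e), w = w' ++ [L.lp l e]}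

end LambdaGraphBisystem

/-- The axioms making a pair of labeled Bratteli diagrams a λ-graph bisystem
satisfying FPCC. -/
structure IsLGBS {A : Type} (L : LambdaGraphBisystem A) : Prop where
  subsingletonV0 : Subsingleton (L.V 0)
  rightResolving : ∀ l (e f : L.Em l), L.sm l e = L.sm l f → L.lm l e = L.lm l f → e = f
  leftResolving : ∀ l (e f : L.Ep l), L.tp l e = L.tp l f → L.lp l e = L.lp l f → e = f
  localProperty : ∀ (l : ℕ) (u : L.V l) (v : L.V (l + 2)),
    ∃ φ : {fp : L.Ep l × L.Em (l + 1) //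
            L.sp l fp.1 = u ∧ L.tp l fp.1 = L.tm (l + 1) fp.2 ∧ L.sm (l + 1) fp.2 = v} ≃
          {ee : L.Em l × L.Ep (l + 1) //
            L.tm l ee.1 = u ∧ L.sm l ee.1 = L.sp (l + 1) ee.2 ∧ L.tp (l + 1) ee.2 = v},
      ∀ fp, L.lp l fp.val.1 = L.lp (l + 1) (φ fp).val.2 ∧
            L.lm (l + 1) fp.val.2 = L.lm l (φ fp).val.1
  fpcc : ∀ l (v : L.V l), L.Fset l v = L.Pset l v

variable {A : Type}

/-! ## The configuration space.

A configuration is indexed here by coordinates `(k, n)` where `k : ℤ` is the row and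
`n : ℕ` is the level; the pair `(k, n)` corresponds to the position `(k, l)` of the paper
with `l = k + n + 1` (so `n = n(k,l) = l - k - 1`).  `v k n` is the vertex `v_{(k,l)}`,
`em k n` is the edge `e⁻_{(k-1,k),l} ∈ E⁻_{n(k-1,l),n(k,l)}` and `ep k n` is the edge
`e⁺_{k,(l,l+1)} ∈ E⁺_{n(k,l),n(k,l+1)}`. -/

structure Config {A : Type} (L : LambdaGraphBisystem A) where
  v : ℤ → ∀ n : ℕ, L.V n
  em : ℤ → ∀ n : ℕ, L.Em n
  ep : ℤ → ∀ n : ℕ, L.Ep n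
  em_s : ∀ (k : ℤ) (n : ℕ), L.sm n (em k n) = v (k - 1) (n + 1)
  em_t : ∀ (k : ℤ) (n : ℕ), L.tm n (em k n) = v k n
  ep_s : ∀ (k : ℤ) (n : ℕ), L.sp n (ep k n) = v k n
  ep_t : ∀ (k : ℤ) (n : ℕ), L.tp n (ep k n) = v k (n + 1)
  label : ∃ xs : ℤ → A, (∀ (k : ℤ) (n : ℕ), L.lm n (em k n) = xs k) ∧
    (∀ (k : ℤ) (n : ℕ), L.lp n (ep k n) = xs (k + n + 1))

theorem Config.v_congr {L : LambdaGraphBisystem A} (x : Config L) {a b : ℤ} (n : ℕ)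
    (h : a = b) : x.v a n = x.v b n := by rw [h]

/-- The word `P_x(v_{(p,q)})` of `λ⁺`-labels along row `p`, of length `n = q - p - 1`. -/
def Pword {L : LambdaGraphBisystem A} (x : Config L) (p : ℤ) : ℕ → List A
  | 0 => []
  | n + 1 => Pword x p n ++ [L.lp n (x.ep p n)]

/-- The cylinder set `U_{(μ; v)}` for a vertex `v` at position `(p, p + n + 1)`. -/
def Cyl {L : LambdaGraphBisystem A} (p : ℤ) (n : ℕ) (v : L.V n) (μ : List A) :
    Set (Config L) :=
  {x | x.v p n = v ∧ Pword x p n = μ}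

def cylinderSets (L : LambdaGraphBisystem A) : Set (Set (Config L)) :=
  {U | ∃ (p : ℤ) (n : ℕ) (v : L.V n) (μ : List A), μ ∈ L.Pset n v ∧ U = Cyl p n v μ}

/-- The topology on the configuration space generated by the cylinder sets. -/
def configTop (L : LambdaGraphBisystem A) : TopologicalSpace (Config L) :=
  TopologicalSpace.generateFrom (cylinderSets L)

instance (L : LambdaGraphBisystem A) : TopologicalSpace (Config L) := configTop L
/-! ## Triangles and the metric -/

/-- Equality of the `(p,q)`-triangles `△_{(p,q)}(x) = △_{(p,q)}(z)`:
the restrictions of the two configurations to `{(k,l) : p ≤ k < l ≤ q}` coincide. -/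
def TriEq {L : LambdaGraphBisystem A} (x z : Config L) (p q : ℤ) : Prop :=
  (∀ (k : ℤ) (n : ℕ), p ≤ k → k + n + 1 ≤ q → x.v k n = z.v k n) ∧
  (∀ (k : ℤ) (n : ℕ), p + 1 ≤ k → k + n + 1 ≤ q → x.em k n = z.em k n) ∧
  (∀ (k : ℤ) (n : ℕ), p ≤ k → k + n + 2 ≤ q → x.ep k n = z.ep k n)

open scoped Classical in
/-- The metric on `X_L` defined from agreement of central triangles:
`d(x,z) ≤ 1/2^p` iff `△_{(-p,p)}(x) = △_{(-p,p)}(z)`. -/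
noncomputable def configDist {L : LambdaGraphBisystem A} (x z : Config L) : ℝ :=
  ⨅ p : ℕ, if TriEq x z (-(p : ℤ)) (p : ℤ) then ((1 : ℝ) / 2) ^ p else 1

/-! ## Standalone (p,q)-triangles -/

structure Triangle {A : Type} (L : LambdaGraphBisystem A) (p q : ℤ) where
  v : ∀ (k : ℤ) (n : ℕ), p ≤ k → k + n + 1 ≤ q → L.V n
  em : ∀ (k : ℤ) (n : ℕ), p + 1 ≤ k → k + n + 1 ≤ q → L.Em n
  ep : ∀ (k : ℤ) (n : ℕ), p ≤ k → k + n + 2 ≤ q → L.Ep n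
  em_s : ∀ (k : ℤ) (n : ℕ) (h : p + 1 ≤ k) (h' : k + n + 1 ≤ q),
    L.sm n (em k n h h') = v (k - 1) (n + 1) (by omega) (by omega)
  em_t : ∀ (k : ℤ) (n : ℕ) (h : p + 1 ≤ k) (h' : k + n + 1 ≤ q),
    L.tm n (em k n h h') = v k n (by omega) h'
  ep_s : ∀ (k : ℤ) (n : ℕ) (h : p ≤ k) (h' : k + n + 2 ≤ q),
    L.sp n (ep k n h h') = v k n h (by omega)
  ep_t : ∀ (k : ℤ) (n : ℕ) (h : p ≤ k) (h' : k + n + 2 ≤ q),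
    L.tp n (ep k n h h') = v k (n + 1) h (by omega)
  label : ∃ xs : ℤ → A,
    (∀ (k : ℤ) (n : ℕ) (h : p + 1 ≤ k) (h' : k + n + 1 ≤ q), L.lm n (em k n h h') = xs k) ∧
    (∀ (k : ℤ) (n : ℕ) (h : p ≤ k) (h' : k + n + 2 ≤ q), L.lp n (ep k n h h') = xs (k + n + 1))

/-- The `λ⁺`-label word along the bottom row of a `(p,q)`-triangle. -/
def Triangle.word {L : LambdaGraphBisystem A} {p q : ℤ} (T : Triangle L p q) :
    ∀ n : ℕ, p + n + 1 ≤ q → List A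
  | 0, _ => []
  | n + 1, h => T.word n (by omega) ++ [L.lp n (T.ep p n le_rfl (by omega))]

/-! ## (p,q)-rectangles -/

structure Rect {A : Type} (L : LambdaGraphBisystem A) (p q : ℤ) where
  v : ∀ (k : ℤ) (n : ℕ), k ≤ p → q ≤ k + n + 1 → L.V n
  em : ∀ (k : ℤ) (n : ℕ), k ≤ p → q ≤ k + n + 1 → L.Em n
  ep : ∀ (k : ℤ) (n : ℕ), k ≤ p → q ≤ k + n + 1 → L.Ep n
  em_s : ∀ (k : ℤ) (n : ℕ) (h : k ≤ p) (h' : q ≤ k + n + 1),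
    L.sm n (em k n h h') = v (k - 1) (n + 1) (by omega) (by omega)
  em_t : ∀ (k : ℤ) (n : ℕ) (h : k ≤ p) (h' : q ≤ k + n + 1),
    L.tm n (em k n h h') = v k n h h'
  ep_s : ∀ (k : ℤ) (n : ℕ) (h : k ≤ p) (h' : q ≤ k + n + 1),
    L.sp n (ep k n h h') = v k n h h'
  ep_t : ∀ (k : ℤ) (n : ℕ) (h : k ≤ p) (h' : q ≤ k + n + 1),
    L.tp n (ep k n h h') = v k (n + 1) h (by omega)
  label : ∃ xs : ℤ → A,
    (∀ (k : ℤ) (n : ℕ) (h : k ≤ p) (h' : q ≤ k + n + 1), L.lm n (em k n h h') = xs k) ∧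
    (∀ (k : ℤ) (n : ℕ) (h : k ≤ p) (h' : q ≤ k + n + 1), L.lp n (ep k n h h') = xs (k + n + 1))

theorem Rect.v_congr {L : LambdaGraphBisystem A} {p q : ℤ} (R : Rect L p q) {a b : ℤ}
    (n : ℕ) (h : a = b) {h1 : a ≤ p} {h2 : q ≤ a + n + 1} {h3 : b ≤ p} {h4 : q ≤ b + n + 1} :
    R.v a n h1 h2 = R.v b n h3 h4 := by subst h; rfl

/-- The `(p,q)`-rectangle `□_{(p,q)}(x)` of a configuration `x`. -/
def Config.toRect {L : LambdaGraphBisystem A} (x : Config L) (p q : ℤ) : Rect L p q where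
  v k n _ _ := x.v k n
  em k n _ _ := x.em k n
  ep k n _ _ := x.ep k n
  em_s k n _ _ := x.em_s k n
  em_t k n _ _ := x.em_t k n
  ep_s k n _ _ := x.ep_s k n
  ep_t k n _ _ := x.ep_t k n
  label := by
    obtain ⟨xs, h1, h2⟩ := x.label
    exact ⟨xs, fun k n _ _ => h1 k n, fun k n _ _ => h2 k n⟩

/-- The upper left corner vertex of a `(p,q)`-rectangle. -/
def Rect.corner {L : LambdaGraphBisystem A} {p q : ℤ} (R : Rect L p q) (n₀ : ℕ)
    (hn : (n₀ : ℤ) = q - p - 1) : L.V n₀ :=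
  R.v p n₀ le_rfl (by omega)

/-! ## Zigzag paths -/

/-- A zigzag path starting from a vertex `v ∈ V_{(p,q)}`, `n₀ = n(p,q)`:
`ep k` is `e⁺_{p-k,(q+k,q+k+1)}` and `em k` is `e⁻_{(p-k-1,p-k),q+k+1}`. -/
structure Zigzag {A : Type} (L : LambdaGraphBisystem A) (n₀ : ℕ) (v : L.V n₀) where
  ep : ∀ k : ℕ, L.Ep (n₀ + 2 * k)
  em : ∀ k : ℕ, L.Em (n₀ + 2 * k + 1)
  start : L.sp n₀ (ep 0) = v
  turn1 : ∀ k : ℕ, L.tp (n₀ + 2 * k) (ep k) = L.tm (n₀ + 2 * k + 1) (em k)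
  turn2 : ∀ k : ℕ, L.sm (n₀ + 2 * k + 1) (em k) = L.sp (n₀ + 2 * k + 2) (ep (k + 1))

/-- The vertex `v_{(p-k, q+k)}` visited by a zigzag path. -/
def Zigzag.vert {L : LambdaGraphBisystem A} {n₀ : ℕ} {v : L.V n₀} (γ : Zigzag L n₀ v)
    (k : ℕ) : L.V (n₀ + 2 * k) := L.sp (n₀ + 2 * k) (γ.ep k)

/-- The vertex `v_{(p-k, q+k+1)}` visited by a zigzag path. -/
def Zigzag.vert' {L : LambdaGraphBisystem A} {n₀ : ℕ} {v : L.V n₀} (γ : Zigzag L n₀ v)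
    (k : ℕ) : L.V (n₀ + 2 * k + 1) := L.tp (n₀ + 2 * k) (γ.ep k)

/-- The zigzag path obtained by restricting a `(p,q)`-rectangle. -/
def Rect.toZigzag {L : LambdaGraphBisystem A} {p q : ℤ} (R : Rect L p q) (n₀ : ℕ)
    (hn : (n₀ : ℤ) = q - p - 1) : Zigzag L n₀ (R.corner n₀ hn) where
  ep k := R.ep (p - k) (n₀ + 2 * k) (by omega) (by omega)
  em k := R.em (p - k) (n₀ + 2 * k + 1) (by omega) (by omega)
  start := (R.ep_s _ _ _ _).trans (R.v_congr _ (by simp))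
  turn1 k := (R.ep_t _ _ _ _).trans (R.em_t _ _ _ _).symm
  turn2 k := (R.em_s _ _ _ _).trans
    ((R.v_congr _ (by push_cast; ring)).trans (R.ep_s _ _ _ _).symm)
/-! ## Zigzag paths with head symbol -/

/-- The set `Z_L`: a zigzag path starting from a vertex of `V_1 = V_{(-1,1)}`
together with a head symbol `x₀`. -/
structure ZigzagHead {A : Type} (L : LambdaGraphBisystem A) where
  x0 : A
  v : L.V 1
  γ : Zigzag L 1 v
  head : ∃ e : L.Ep 0, L.lp 0 e = x0 ∧ L.tp 0 e = v

/-- Restriction of a configuration to its zigzag path with head symbol. -/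
def Config.toZigzagHead {L : LambdaGraphBisystem A} (x : Config L) : ZigzagHead L where
  x0 := L.lp 0 (x.ep (-1) 0)
  v := x.v (-1) 1
  γ :=
  { ep := fun k => x.ep (-1 - (k : ℤ)) (1 + 2 * k)
    em := fun k => x.em (-1 - (k : ℤ)) (1 + 2 * k + 1)
    start := (x.ep_s _ _).trans (x.v_congr _ (by simp))
    turn1 := fun k => (x.ep_t _ _).trans (x.em_t _ _).symm
    turn2 := fun k => (x.em_s _ _).trans
      ((x.v_congr _ (by push_cast; ring)).trans (x.ep_s _ _).symm) }
  head := ⟨x.ep (-1) 0, rfl, x.ep_t (-1) 0⟩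

/-- Condition (I): every vertex admits at least two zigzag paths starting from it. -/
def ConditionI (L : LambdaGraphBisystem A) : Prop :=
  ∀ (p q : ℤ), p < q → ∀ v : L.V (q - p - 1).toNat,
    ∃ γ₁ γ₂ : Zigzag L (q - p - 1).toNat v, γ₁ ≠ γ₂

/-! ## The AF-equivalence relation -/

/-- `□_{(p,q)}(x) = □_{(p,q)}(z)` : the restrictions of the two configurations to the
lower right infinite rectangle `{(k,l) : k ≤ p, q ≤ l}` coincide. -/
def RectEq {L : LambdaGraphBisystem A} (x z : Config L) (p q : ℤ) : Prop :=
  ∀ (k : ℤ) (n : ℕ), k ≤ p → q ≤ k + n + 1 →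
    x.v k n = z.v k n ∧ x.em k n = z.em k n ∧ x.ep k n = z.ep k n

/-- The relation `x ∼ z` on `X_L`. -/
def ConfigRel {L : LambdaGraphBisystem A} (x z : Config L) : Prop :=
  ∃ p q : ℤ, p < q ∧ RectEq x z p q

/-- The subequivalence relation `R_{L,(p,q)}` as a subset of `X_L × X_L`. -/
def RpqSet (L : LambdaGraphBisystem A) (p q : ℤ) : Set (Config L × Config L) :=
  {xz | RectEq xz.1 xz.2 p q}

/-- The equivalence relation `R_L` as a subset of `X_L × X_L`. -/
def Rset (L : LambdaGraphBisystem A) : Set (Config L × Config L) :=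
  {xz | ∃ p q : ℤ, p < q ∧ RectEq xz.1 xz.2 p q}

/-- The inclusion `R_{L,(p,q)} → R_L`. -/
def inclPQ (L : LambdaGraphBisystem A) (p q : ℤ) (h : p < q) (y : ↥(RpqSet L p q)) :
    ↥(Rset L) := ⟨y.val, ⟨p, q, h, y.prop⟩⟩

/-- The inductive limit topology on `R_L = ⋃ R_{L,(p,q)}`, where each `R_{L,(p,q)}`
carries the relative topology of `X_L × X_L`. -/
def indTop (L : LambdaGraphBisystem A) : TopologicalSpace ↥(Rset L) :=
  ⨆ (p : ℤ) (q : ℤ) (h : p < q),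
    TopologicalSpace.coinduced (inclPQ L p q h) inferInstance

/-! ## The shift -/

/-- The shift `σ_L^m` on the configuration space, `σ_L^m(x)_{(k,l)} = x_{(k+m,l+m)}`. -/
def shiftBy (L : LambdaGraphBisystem A) (m : ℤ) (x : Config L) : Config L where
  v k n := x.v (k + m) n
  em k n := x.em (k + m) n
  ep k n := x.ep (k + m) n
  em_s k n := (x.em_s (k + m) n).trans (x.v_congr (n + 1) (by ring))
  em_t k n := x.em_t (k + m) n
  ep_s k n := x.ep_s (k + m) n
  ep_t k n := x.ep_t (k + m) n
  label := by
    obtain ⟨xs, h1, h2⟩ := x.label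
    refine ⟨fun k => xs (k + m), fun k n => h1 (k + m) n, fun k n => (h2 (k + m) n).trans ?_⟩
    congr 1
    ring

/-- The label sequence `π(x) = (x_n)_{n ∈ ℤ}` of a configuration. -/
def configSeq {L : LambdaGraphBisystem A} (x : Config L) : ℤ → A :=
  fun k => L.lm 0 (x.em k 0)

/-! ## The groupoid `G_L = R_L ⋊ ℤ` -/

/-- `G_L = {(x,n,z) : (σ_L^n(x), z) ∈ R_L}`. -/
def GLset (L : LambdaGraphBisystem A) : Set (Config L × ℤ × Config L) :=
  {g | (shiftBy L g.2.1 g.1, g.2.2) ∈ Rset L}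

/-- The canonical bijection `(x,n,z) ↦ ((σ_L^n(x), z), n)` of `G_L` with `R_L × ℤ`. -/
def GLmap (L : LambdaGraphBisystem A) (g : ↥(GLset L)) : ↥(Rset L) × ℤ :=
  (⟨(shiftBy L g.val.2.1 g.val.1, g.val.2.2), g.prop⟩, g.val.2.1)

/-- The topology on `G_L` transported from `R_L × ℤ` (with `R_L` carrying the
inductive limit topology). -/
def GLtop (L : LambdaGraphBisystem A) : TopologicalSpace ↥(GLset L) :=
  TopologicalSpace.induced (GLmap L) (@instTopologicalSpaceProd _ _ (indTop L) _)

/-- `(X_L, σ_L)` is equivalently essentially free. -/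
def EquivEssFree (L : LambdaGraphBisystem A) : Prop :=
  ∀ n : ℤ, n ≠ 0 → interior {x : Config L | (shiftBy L n x, x) ∈ Rset L} = ∅

/-! ## Irreducibility -/

/-- Irreducibility of a λ-graph bisystem: every zigzag path `γ` from a vertex of
`V_1 = V_{(-1,1)}` is met by some zigzag path `η` from any prescribed vertex of
`V_{(-p,p)} = V_{2p-1}`; meeting means passing through the same vertex. -/
def IrreducibleLGBS (L : LambdaGraphBisystem A) : Prop :=
  ∀ p : ℕ, 1 ≤ p → ∀ (w : L.V (2 * p - 1)) (v : L.V 1) (γ : Zigzag L 1 v),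
    ∃ η : Zigzag L (2 * p - 1) w, ∃ k j : ℕ, 1 + 2 * k = 2 * p - 1 + 2 * j ∧
      (HEq (γ.vert k) (η.vert j) ∨ HEq (γ.vert' k) (η.vert' j))
/-! ## Subshifts and the canonical λ-graph bisystem -/

/-- The product topology on `ℤ → A` with `A` discrete. -/
def seqTop (A : Type) : TopologicalSpace (ℤ → A) :=
  @Pi.topologicalSpace ℤ (fun _ => A) (fun _ => ⊥)

/-- A two-sided subshift over the alphabet `A`. -/
structure Subshift (A : Type) where
  carrier : Set (ℤ → A)
  nonempty : carrier.Nonempty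
  closed : @IsClosed (ℤ → A) (seqTop A) carrier
  shiftInv : ∀ a : ℤ → A, a ∈ carrier ↔ (fun n => a (n + 1)) ∈ carrier

/-- The subspace topology on a subshift. -/
def subTop (S : Subshift A) : TopologicalSpace {a // a ∈ S.carrier} :=
  TopologicalSpace.induced Subtype.val (seqTop A)

/-- The shift homeomorphism on a subshift. -/
def Subshift.shiftMap (S : Subshift A) (a : {a // a ∈ S.carrier}) : {a // a ∈ S.carrier} :=
  ⟨fun n => a.val (n + 1), (S.shiftInv a.val).1 a.prop⟩

/-- A topological conjugacy between two subshifts. -/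
structure Conjugacy {A₁ A₂ : Type} (S₁ : Subshift A₁) (S₂ : Subshift A₂) where
  toFun : {a // a ∈ S₁.carrier} → {b // b ∈ S₂.carrier}
  invFun : {b // b ∈ S₂.carrier} → {a // a ∈ S₁.carrier}
  left_inv : Function.LeftInverse invFun toFun
  right_inv : Function.RightInverse invFun toFun
  continuous_toFun : @Continuous _ _ (subTop S₁) (subTop S₂) toFun
  continuous_invFun : @Continuous _ _ (subTop S₂) (subTop S₁) invFun
  equivariant : ∀ a, toFun (S₁.shiftMap a) = S₂.shiftMap (toFun a)

/-- `splice x l w` replaces the entries of `x` at positions `-l+1, …, 0` by the word `w`. -/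
def splice (x : ℤ → A) (l : ℕ) (w : Fin l → A) : ℤ → A :=
  fun i => if h : -(l : ℤ) + 1 ≤ i ∧ i ≤ 0 then w ⟨(i + l - 1).toNat, by omega⟩ else x i

/-- The set `W_{-l,1}(x)` of `(-l,1)`-central words of `x`. -/
def Wset (S : Subshift A) (l : ℕ) (x : ℤ → A) : Set (Fin l → A) :=
  {w | splice x l w ∈ S.carrier}

/-- `(-l,1)`-central equivalence. -/
def centralSetoid (S : Subshift A) (l : ℕ) : Setoid {a // a ∈ S.carrier} where
  r x z := Wset S l x.val = Wset S l z.val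
  iseqv := ⟨fun _ => rfl, Eq.symm, Eq.trans⟩

/-- The vertex set `V_l = Ω_{-l,1}` of the canonical λ-graph bisystem. -/
def Vcan (S : Subshift A) (l : ℕ) : Type := Quotient (centralSetoid S l)

noncomputable def VcanFintype [Fintype A] (S : Subshift A) (l : ℕ) : Fintype (Vcan S l) := by
  classical
  have : Fintype (Set (Fin l → A)) := Fintype.ofFinite _
  exact Fintype.ofInjective
    (Quotient.lift (fun x : {a // a ∈ S.carrier} => Wset S l x.val) (fun _ _ h => h))
    (fun a b => Quotient.inductionOn₂ a b (fun _ _ h => Quotient.sound h))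

/-- The edge set `E⁻_{l+1,l}` of the canonical λ-graph bisystem: there is an edge labeled
`β` from the class of `x` in `V_{l+1}` to the class of the point obtained from `x` by
inserting `β` at the left end of the central window. -/
def EmCan (S : Subshift A) (l : ℕ) : Type :=
  {t : Vcan S (l + 1) × A × Vcan S l //
    ∃ x : {a // a ∈ S.carrier}, Quotient.mk (centralSetoid S (l + 1)) x = t.1 ∧
      ∃ w : Fin (l + 1) → A, w ⟨0, Nat.succ_pos l⟩ = t.2.1 ∧
        ∃ h : splice x.val (l + 1) w ∈ S.carrier,
          Quotient.mk (centralSetoid S l) ⟨splice x.val (l + 1) w, h⟩ = t.2.2}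

/-- The inverse shift `σ⁻¹` on sequences. -/
def shiftR (a : ℤ → A) : ℤ → A := fun n => a (n - 1)

/-- The edge set `E⁺_{l,l+1}` of the canonical λ-graph bisystem: there is an edge labeled
`α` ending at the class of `x` in `V_{l+1}` whose source is the class (in `V_l`, after
the canonical shift identification) of the point obtained from `x` by inserting `α` at
the right end of the central window. -/
def EpCan (S : Subshift A) (l : ℕ) : Type :=
  {t : Vcan S l × A × Vcan S (l + 1) //
    ∃ x : {a // a ∈ S.carrier}, Quotient.mk (centralSetoid S (l + 1)) x = t.2.2 ∧
      ∃ w : Fin (l + 1) → A, w ⟨l, Nat.lt_succ_self l⟩ = t.2.1 ∧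
        ∃ h : shiftR (splice x.val (l + 1) w) ∈ S.carrier,
          Quotient.mk (centralSetoid S l) ⟨shiftR (splice x.val (l + 1) w), h⟩ = t.1}

/-- The canonical λ-graph bisystem `L_Λ` of a subshift `Λ`. -/
noncomputable def canonicalLGBS [Fintype A] (S : Subshift A) : LambdaGraphBisystem A where
  V := Vcan S
  Em := EmCan S
  Ep := EpCan S
  fintypeV := fun l => VcanFintype S l
  nonemptyV := fun l => ⟨Quotient.mk _ ⟨S.nonempty.choose, S.nonempty.choose_spec⟩⟩
  fintypeEm := fun l => by
    classical
    haveI := VcanFintype S (l + 1); haveI := VcanFintype S l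
    unfold EmCan
    exact Fintype.ofFinite _
  fintypeEp := fun l => by
    classical
    haveI := VcanFintype S (l + 1); haveI := VcanFintype S l
    unfold EpCan
    exact Fintype.ofFinite _
  sm := fun _ e => e.val.1
  tm := fun _ e => e.val.2.2
  lm := fun _ e => e.val.2.1
  sp := fun _ e => e.val.1
  tp := fun _ e => e.val.2.2
  lp := fun _ e => e.val.2.1

namespace GI

set_option linter.unusedSectionVars false

def Wv (S : Subshift A) (n : ℕ) : Vcan S n → Set (Fin n → A) :=
  Quotient.lift (fun x : {a // a ∈ S.carrier} => Wset S n x.val) (fun _ _ h => h)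

theorem Wv_inj (S : Subshift A) (n : ℕ) : Function.Injective (Wv S n) :=
  fun a b => Quotient.inductionOn₂ a b (fun _ _ h => Quotient.sound h)

def word (b : ℤ → A) (k : ℤ) (n : ℕ) : Fin n → A := fun i => b (k + 1 + (i : ℕ))

def put (y : ℤ → A) (k : ℤ) (n : ℕ) (b : ℤ → A) : ℤ → A :=
  fun i => if k < i ∧ i ≤ k + n then b i else y i

def sh (m : ℤ) (a : ℤ → A) : ℤ → A := fun i => a (i + m)

theorem sh_sh (m n : ℤ) (a : ℤ → A) : sh m (sh n a) = sh (m + n) a := by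
  funext i; simp [sh, add_assoc]

theorem sh_zero (a : ℤ → A) : sh 0 a = a := by
  funext i; simp [sh]

theorem sh_mem (S : Subshift A) (m : ℤ) (a : ℤ → A) : sh m a ∈ S.carrier ↔ a ∈ S.carrier := by
  induction m using Int.induction_on generalizing a with
  | zero => rw [sh_zero]
  | succ i ih =>
    rw [show ((i : ℤ) + 1) = 1 + i by ring, ← sh_sh]
    rw [← ih a]
    exact (S.shiftInv (sh i a)).symm
  | pred i ih =>
    rw [← ih a]
    have e : sh (-(i : ℤ)) a = sh 1 (sh (-i - 1) a) := by
      rw [sh_sh]; congr 1; ring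
    rw [e]
    exact (S.shiftInv (sh _ a))

theorem splice_word (y b : ℤ → A) (k : ℤ) (n : ℕ) :
    splice (sh (k + n) y) n (word b k n) = sh (k + n) (put y k n b) := by
  funext i
  unfold splice sh put word
  split_ifs with h1 h2 h2
  · congr 1
    dsimp only
    omega
  · omega
  · omega
  · rfl

theorem Wv_mk (S : Subshift A) (y : ℤ → A) (k : ℤ) (n : ℕ) (hy : sh (k + n) y ∈ S.carrier)
    (b : ℤ → A) :
    word b k n ∈ Wv S n (Quotient.mk (centralSetoid S n) ⟨sh (k + n) y, hy⟩) ↔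
      put y k n b ∈ S.carrier := by
  show splice (sh (k + n) y) n (word b k n) ∈ S.carrier ↔ _
  rw [splice_word, sh_mem]

theorem em_iff (S : Subshift A) (l : ℕ) (e : EmCan S l) (k : ℤ) (b : ℤ → A)
    (hb : b k = e.val.2.1) :
    word b k l ∈ Wv S l e.val.2.2 ↔ word b (k - 1) (l + 1) ∈ Wv S (l + 1) e.val.1 := by
  obtain ⟨⟨v, β, u⟩, x, hx, w, hw, hmem, hu⟩ := e
  dsimp only at *
  subst hx hu hw
  show splice (splice x.val (l + 1) w) l (word b k l) ∈ S.carrier ↔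
    splice x.val (l + 1) (word b (k - 1) (l + 1)) ∈ S.carrier
  have : splice (splice x.val (l + 1) w) l (word b k l) =
    splice x.val (l + 1) (word b (k - 1) (l + 1)) := by
    funext i
    unfold splice word
    split_ifs with h1 h2 h2
    · congr 1
      push_cast
      omega
    · push_cast at h2
      omega
    · push_cast at h2
      have hi : i = - (l : ℤ) := by omega
      subst hi
      have e1 : (⟨(-(l : ℤ) + (l + 1 : ℕ) - 1).toNat, by omega⟩ : Fin (l + 1)) =
        ⟨0, Nat.succ_pos l⟩ := by
        ext; simp
      rw [e1, ← hb]
      congr 1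
      simp
    · rfl
  rw [this]

theorem ep_iff (S : Subshift A) (l : ℕ) (e : EpCan S l) (k : ℤ) (b : ℤ → A)
    (hb : b (k + l + 1) = e.val.2.1) :
    word b k l ∈ Wv S l e.val.1 ↔ word b k (l + 1) ∈ Wv S (l + 1) e.val.2.2 := by
  obtain ⟨⟨v, β, u⟩, x, hx, w, hw, hmem, hu⟩ := e
  dsimp only at *
  subst hx hu hw
  show splice (shiftR (splice x.val (l + 1) w)) l (word b k l) ∈ S.carrier ↔
    splice x.val (l + 1) (word b k (l + 1)) ∈ S.carrier
  have : splice (shiftR (splice x.val (l + 1) w)) l (word b k l) =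
    sh (-1) (splice x.val (l + 1) (word b k (l + 1))) := by
    funext i
    unfold splice shiftR sh word
    dsimp only
    split_ifs with h1 h2 h2 h3 h3
    · congr 1
      push_cast
      omega
    · push_cast at h2
      omega
    · push_cast at h2
      have hi : i = 1 := by omega
      subst hi
      have e1 : (⟨(1 - 1 + ((l + 1 : ℕ) : ℤ) - 1).toNat, by omega⟩ : Fin (l + 1)) =
        ⟨l, Nat.lt_succ_self l⟩ := by
        ext; simp
      rw [e1, ← hb]
      congr 1
      push_cast
      omega
    · omega
    · omega
    · rfl
  rw [this, sh_mem]

variable [Fintype A] {S : Subshift A}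

theorem lm_eq (x : Config (canonicalLGBS S)) (k : ℤ) (n : ℕ) :
    (canonicalLGBS S).lm n (x.em k n) = configSeq x k := by
  obtain ⟨xs, h1, h2⟩ := x.label
  unfold configSeq
  rw [h1, h1]

theorem lp_eq (x : Config (canonicalLGBS S)) (k : ℤ) (n : ℕ) :
    (canonicalLGBS S).lp n (x.ep k n) = configSeq x (k + n + 1) := by
  obtain ⟨xs, h1, h2⟩ := x.label
  unfold configSeq
  rw [h1, h2]

def W (x : Config (canonicalLGBS S)) (k : ℤ) (n : ℕ) : Set (Fin n → A) := Wv S n (x.v k n)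

theorem W_left (x : Config (canonicalLGBS S)) (k : ℤ) (n : ℕ) (b : ℤ → A)
    (hb : b k = configSeq x k) :
    word b k n ∈ W x k n ↔ word b (k - 1) (n + 1) ∈ W x (k - 1) (n + 1) := by
  unfold W
  have := em_iff S n (x.em k n) k b (hb.trans (lm_eq x k n).symm)
  rw [← x.em_t, ← x.em_s]
  exact this

theorem W_right (x : Config (canonicalLGBS S)) (k : ℤ) (n : ℕ) (b : ℤ → A)
    (hb : b (k + n + 1) = configSeq x (k + n + 1)) :
    word b k n ∈ W x k n ↔ word b k (n + 1) ∈ W x k (n + 1) := by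
  unfold W
  have := ep_iff S n (x.ep k n) k b (hb.trans (lp_eq x k n).symm)
  rw [← x.ep_t, ← x.ep_s]
  exact this

/-- `b` agrees with `a` off the window `(k, k+n]`. -/
def Off (k : ℤ) (n : ℕ) (a b : ℤ → A) : Prop := ∀ i, (i ≤ k ∨ k + n < i) → b i = a i

theorem W_right_many (x : Config (canonicalLGBS S)) (k : ℤ) (n m : ℕ) (b : ℤ → A)
    (hb : Off k n (configSeq x) b) :
    word b k n ∈ W x k n ↔ word b k (n + m) ∈ W x k (n + m) := by
  induction m with
  | zero => rfl
  | succ m ih =>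
    rw [ih, ← add_assoc]
    apply W_right
    apply hb
    push_cast; omega

theorem W_left_many (x : Config (canonicalLGBS S)) (k : ℤ) (n m : ℕ) (b : ℤ → A)
    (hb : Off k n (configSeq x) b) :
    word b k n ∈ W x k n ↔ word b (k - m) (n + m) ∈ W x (k - m) (n + m) := by
  induction m with
  | zero => simp
  | succ m ih =>
    rw [ih, ← add_assoc]
    have := W_left x (k - m) (n + m) b (hb _ (by omega))
    rw [this]
    push_cast
    rw [sub_sub]

theorem W_window (x : Config (canonicalLGBS S)) (k k' : ℤ) (n n' : ℕ) (b : ℤ → A)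
    (hb : Off k n (configSeq x) b) (h1 : k' ≤ k) (h2 : k + n ≤ k' + n') :
    word b k n ∈ W x k n ↔ word b k' n' ∈ W x k' n' := by
  obtain ⟨m, hm⟩ := Int.eq_ofNat_of_zero_le (sub_nonneg.2 h1)
  obtain ⟨m', hm'⟩ := Int.eq_ofNat_of_zero_le (sub_nonneg.2 h2)
  rw [W_left_many x k n m b hb]
  have e : k' = k - m := by omega
  subst e
  have e : n' = n + m + m' := by omega
  subst e
  apply W_right_many
  intro i hi
  apply hb
  push_cast at *
  omega

def Tset (x : Config (canonicalLGBS S)) : Set (ℤ → A) :=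
  {b | ∃ (k : ℤ) (n : ℕ), Off k n (configSeq x) b ∧ word b k n ∈ W x k n}

theorem Tset_iff (x : Config (canonicalLGBS S)) (k : ℤ) (n : ℕ) (b : ℤ → A)
    (hb : Off k n (configSeq x) b) : b ∈ Tset x ↔ word b k n ∈ W x k n := by
  constructor
  · rintro ⟨k', n', h1, h2⟩
    have hK : ∃ K : ℤ, ∃ N : ℕ, K ≤ k ∧ K ≤ k' ∧ k + n ≤ K + N ∧ k' + n' ≤ K + N :=
      ⟨min k k', (max (k + n) (k' + n') - min k k').toNat, by omega, by omega, by omega, by omega⟩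
    obtain ⟨K, N, a1, a2, a3, a4⟩ := hK
    rw [W_window x k' K n' N b h1 a2 a4] at h2
    rw [W_window x k K n N b hb a1 a3]
    exact h2
  · intro h
    exact ⟨k, n, hb, h⟩

theorem seq_mem_Tset (x : Config (canonicalLGBS S)) : configSeq x ∈ Tset x := by
  refine ⟨0, 0, fun _ _ => rfl, ?_⟩
  unfold W
  generalize x.v 0 0 = v
  induction v using Quotient.inductionOn with
  | h a =>
    show splice a.val 0 _ ∈ S.carrier
    convert a.prop
    funext i
    unfold splice
    rw [dif_neg (by push_cast; omega)]

theorem word_mem (x : Config (canonicalLGBS S)) (k : ℤ) (n : ℕ) :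
    word (configSeq x) k n ∈ W x k n :=
  (Tset_iff x k n _ (fun _ _ => rfl)).1 (seq_mem_Tset x)

/-- `y` realizes the pair `(xs, T)` on the window `(k, k+n]`. -/
def Realizes (S : Subshift A) (xs : ℤ → A) (T : Set (ℤ → A)) (k : ℤ) (n : ℕ) (y : ℤ → A) : Prop :=
  y ∈ S.carrier ∧ (∀ i, k < i → i ≤ k + n → y i = xs i) ∧
    ∀ b, Off k n xs b → (b ∈ T ↔ put y k n b ∈ S.carrier)

theorem word_put (y b : ℤ → A) (k : ℤ) (n : ℕ) : word (put y k n b) k n = word b k n := by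
  funext i
  unfold word put
  rw [if_pos]
  omega

theorem exists_word (k : ℤ) (n : ℕ) (xs : ℤ → A) (u : Fin n → A) :
    ∃ b, Off k n xs b ∧ word b k n = u := by
  refine ⟨fun i => if h : k < i ∧ i ≤ k + n then u ⟨(i - k - 1).toNat, by omega⟩ else xs i, ?_, ?_⟩
  · intro i hi
    dsimp only
    rw [dif_neg (by omega)]
  · funext i
    unfold word
    dsimp only
    rw [dif_pos (by omega)]
    congr 1
    ext
    dsimp only
    omega

theorem realizes_iff (x : Config (canonicalLGBS S)) (k : ℤ) (n : ℕ) (y : ℤ → A)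
    (hy : sh (k + n) y ∈ S.carrier) (hyx : ∀ i, k < i → i ≤ k + n → y i = configSeq x i) :
    Realizes S (configSeq x) (Tset x) k n y ↔
      x.v k n = Quotient.mk (centralSetoid S n) ⟨sh (k + n) y, hy⟩ := by
  constructor
  · rintro ⟨h1, h2, h3⟩
    apply Wv_inj S n
    ext u
    obtain ⟨b, hb, rfl⟩ := exists_word k n (configSeq x) u
    rw [Wv_mk, ← h3 b hb, Tset_iff x k n b hb]
    rfl
  · intro h
    refine ⟨(sh_mem _ _ _).1 hy, hyx, fun b hb => ?_⟩
    rw [Tset_iff x k n b hb, ← Wv_mk S y k n hy, ← h]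
    rfl

theorem exists_realizes (x : Config (canonicalLGBS S)) (k : ℤ) (n : ℕ) :
    ∃ y, Realizes S (configSeq x) (Tset x) k n y := by
  obtain ⟨a, ha⟩ := Quotient.exists_rep (x.v k n)
  have e : sh (k + n) (sh (-(k + n)) a.val) = a.val := by
    rw [sh_sh, add_neg_cancel, sh_zero]
  have hm : sh (k + n) (sh (-(k + n)) a.val) ∈ S.carrier := by rw [e]; exact a.prop
  have ha' : x.v k n = Quotient.mk (centralSetoid S n) ⟨_, hm⟩ := by
    rw [← ha]; congr 1; exact Subtype.ext e.symm
  have hw := word_mem x k n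
  unfold W at hw
  rw [ha', Wv_mk] at hw
  refine ⟨_, hw, ?_, ?_⟩
  · intro i h1 h2
    unfold put
    rw [if_pos ⟨h1, h2⟩]
  · intro b hb
    rw [Tset_iff x k n b hb]
    unfold W
    rw [ha', Wv_mk]
    have : put (put (sh (-(k + n)) a.val) k n (configSeq x)) k n b
      = put (sh (-(k + n)) a.val) k n b := by
      funext i
      unfold put
      split_ifs <;> rfl
    rw [this]

theorem mem_of_approx (S : Subshift A) (b : ℤ → A)
    (h : ∀ N : ℕ, ∃ y ∈ S.carrier, ∀ i : ℤ, -N < i → i ≤ N → y i = b i) : b ∈ S.carrier := by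
  let _ : TopologicalSpace A := ⊥
  have : DiscreteTopology A := ⟨rfl⟩
  have hc : IsClosed S.carrier := S.closed
  choose y hy hyb using h
  refine hc.mem_of_tendsto (f := y) (b := Filter.atTop) ?_ (Filter.Eventually.of_forall hy)
  rw [tendsto_pi_nhds]
  intro i
  apply tendsto_const_nhds.congr'
  filter_upwards [Filter.eventually_ge_atTop (i.natAbs + 1)] with N hN
  exact (hyb N i (by omega) (by omega)).symm

theorem Tset_sub (x : Config (canonicalLGBS S)) : Tset x ⊆ S.carrier := by
  rintro b ⟨k, n, h1, h2⟩
  apply mem_of_approx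
  intro N
  obtain ⟨K, M, hK⟩ : ∃ K : ℤ, ∃ M : ℕ, K ≤ k ∧ K ≤ -N ∧ k + n ≤ K + M ∧ N ≤ K + M :=
    ⟨min k (-N), (max (k + n) N - min k (-N)).toNat, by omega, by omega, by omega, by omega⟩
  obtain ⟨y, hy1, hy2, hy3⟩ := exists_realizes x K M
  refine ⟨put y K M b, (hy3 b (fun i hi => h1 i (by omega))).1 ⟨k, n, h1, h2⟩, ?_⟩
  intro i a1 a2
  unfold put
  rw [if_pos (by omega)]

theorem seq_mem (x : Config (canonicalLGBS S)) : configSeq x ∈ S.carrier :=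
  Tset_sub x (seq_mem_Tset x)

theorem config_ext (x z : Config (canonicalLGBS S)) (hv : x.v = z.v)
    (hem : x.em = z.em) (hep : x.ep = z.ep) : x = z := by
  cases x; cases z
  dsimp only at hv hem hep
  subst hv hem hep
  rfl

theorem v_eq {x z : Config (canonicalLGBS S)} (hT : Tset x = Tset z) (k : ℤ) (n : ℕ)
    (h : Off k n (configSeq x) (configSeq z)) : x.v k n = z.v k n := by
  apply Wv_inj S n
  ext u
  obtain ⟨b, hb, rfl⟩ := exists_word k n (configSeq x) u
  have h1 := Tset_iff x k n b hb
  have h2 := Tset_iff z k n b (fun i hi => (hb i hi).trans (h i hi).symm)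
  rw [hT] at h1
  exact h1.symm.trans h2

theorem em_eq {x z : Config (canonicalLGBS S)} (k : ℤ) (n : ℕ)
    (h1 : x.v (k - 1) (n + 1) = z.v (k - 1) (n + 1)) (h2 : x.v k n = z.v k n)
    (h3 : configSeq x k = configSeq z k) : x.em k n = z.em k n := by
  rw [← x.em_t, ← z.em_t] at h2
  rw [← x.em_s, ← z.em_s] at h1
  rw [← lm_eq x k n, ← lm_eq z k n] at h3
  exact Subtype.ext (Prod.ext h1 (Prod.ext h3 h2))

theorem ep_eq {x z : Config (canonicalLGBS S)} (k : ℤ) (n : ℕ)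
    (h1 : x.v k (n + 1) = z.v k (n + 1)) (h2 : x.v k n = z.v k n)
    (h3 : configSeq x (k + n + 1) = configSeq z (k + n + 1)) : x.ep k n = z.ep k n := by
  rw [← x.ep_t, ← z.ep_t] at h1
  rw [← x.ep_s, ← z.ep_s] at h2
  rw [← lp_eq x k n, ← lp_eq z k n] at h3
  exact Subtype.ext (Prod.ext h2 (Prod.ext h3 h1))

theorem rectEq_iff (x z : Config (canonicalLGBS S)) (p q : ℤ) (hpq : p < q) :
    RectEq x z p q ↔ Tset x = Tset z ∧ ∀ i, (i ≤ p ∨ q ≤ i) → configSeq x i = configSeq z i := by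
  constructor
  · intro h
    have hs : ∀ i, (i ≤ p ∨ q ≤ i) → configSeq x i = configSeq z i := by
      rintro i (hi | hi)
      · rw [← lm_eq x i (q - i).toNat, ← lm_eq z i (q - i).toNat, (h i (q - i).toNat hi (by omega)).2.1]
      · have e : i = p + (i - p - 1).toNat + 1 := by omega
        rw [e, ← lp_eq, ← lp_eq, (h p (i - p - 1).toNat le_rfl (by omega)).2.2]
    refine ⟨?_, hs⟩
    ext b
    constructor
    · rintro ⟨k, n, h1, h2⟩
      obtain ⟨K, M, hK⟩ : ∃ K : ℤ, ∃ M : ℕ, K ≤ k ∧ K ≤ p ∧ k + n ≤ K + M ∧ q ≤ K + M + 1 :=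
        ⟨min k p, (max (k + n) q - min k p).toNat, by omega, by omega, by omega, by omega⟩
      rw [W_window x k K n M b h1 (by omega) (by omega)] at h2
      refine ⟨K, M, fun i hi => (h1 i (by omega)).trans (hs i (by omega)), ?_⟩
      unfold W at *
      rw [← (h K M (by omega) (by omega)).1]
      exact h2
    · rintro ⟨k, n, h1, h2⟩
      obtain ⟨K, M, hK⟩ : ∃ K : ℤ, ∃ M : ℕ, K ≤ k ∧ K ≤ p ∧ k + n ≤ K + M ∧ q ≤ K + M + 1 :=
        ⟨min k p, (max (k + n) q - min k p).toNat, by omega, by omega, by omega, by omega⟩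
      rw [W_window z k K n M b h1 (by omega) (by omega)] at h2
      refine ⟨K, M, fun i hi => (h1 i (by omega)).trans (hs i (by omega)).symm, ?_⟩
      unfold W at *
      rw [(h K M (by omega) (by omega)).1]
      exact h2
  · rintro ⟨hT, hs⟩ k n h1 h2
    have hv : ∀ (k : ℤ) (n : ℕ), k ≤ p → q ≤ k + n + 1 → x.v k n = z.v k n := fun k n h1 h2 =>
      v_eq hT k n (fun i hi => (hs i (by omega)).symm)
    exact ⟨hv k n h1 h2, em_eq k n (hv _ _ (by omega) (by push_cast; omega)) (hv k n h1 h2)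
      (hs k (by omega)), ep_eq k n (hv _ _ h1 (by push_cast; omega)) (hv k n h1 h2) (hs _ (by omega))⟩

theorem ext_ST {x z : Config (canonicalLGBS S)} (hs : configSeq x = configSeq z)
    (hT : Tset x = Tset z) : x = z := by
  have hv : ∀ k n, x.v k n = z.v k n := fun k n => v_eq hT k n (fun i _ => (congrFun hs i).symm)
  apply config_ext
  · funext k n; exact hv k n
  · funext k n; exact em_eq k n (hv _ _) (hv _ _) (congrFun hs _)
  · funext k n; exact ep_eq k n (hv _ _) (hv _ _) (congrFun hs _)

theorem exists_config (S : Subshift A) (xs : ℤ → A) (T : Set (ℤ → A))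
    (h : ∀ k n, ∃ y, Realizes S xs T k n y) (hT : ∀ b ∈ T, ∃ k n, Off k n xs b) :
    ∃ x : Config (canonicalLGBS S), configSeq x = xs ∧ Tset x = T := by
  choose y hy1 hy2 hy3 using h
  let V : ℤ → ∀ n : ℕ, Vcan S n := fun k n =>
    Quotient.mk (centralSetoid S n) ⟨sh (k + n) (y k n), (sh_mem _ _ _).2 (hy1 k n)⟩
  have hV : ∀ k n b, Off k n xs b → (word b k n ∈ Wv S n (V k n) ↔ b ∈ T) := by
    intro k n b hb
    rw [Wv_mk, hy3 k n b hb]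
  -- a realizer on a bigger window represents smaller windows
  have key : ∀ (k k' : ℤ) (n n' : ℕ), k' ≤ k → k + n ≤ k' + n' →
      ∀ hm : sh (k + n) (y k' n') ∈ S.carrier,
      Quotient.mk (centralSetoid S n) ⟨sh (k + n) (y k' n'), hm⟩ = V k n := by
    intro k k' n n' h1 h2 hm
    apply Wv_inj S n
    ext u
    obtain ⟨b, hb, rfl⟩ := exists_word k n xs u
    rw [hV k n b hb, Wv_mk, hy3 k' n' b (fun i hi => hb i (by omega))]
    have : put (y k' n') k n b = put (y k' n') k' n' b := by
      funext i
      unfold put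
      split_ifs with a1 a2 a2
      · rfl
      · omega
      · rw [hb i (by omega)]; exact hy2 k' n' i (by omega) (by omega)
      · rfl
    rw [this]
  have hsp : ∀ (k : ℤ) (n : ℕ) (m : ℤ), m = k + n → splice (sh m (y k n)) n (word xs k n) = sh m (y k n) := by
    intro k n m hm
    subst hm
    rw [splice_word]
    congr 1
    funext i
    unfold put
    split_ifs with a
    · exact (hy2 k n i a.1 a.2).symm
    · rfl
  have hem : ∀ (k : ℤ) (n : ℕ), ∃ e : EmCan S n, e.val = (V (k - 1) (n + 1), xs k, V k n) := by
    intro k n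
    have hs := hsp (k - 1) (n + 1) (k - 1 + (n + 1 : ℕ)) rfl
    refine ⟨⟨(V (k - 1) (n + 1), xs k, V k n), ⟨_, (sh_mem _ _ _).2 (hy1 (k - 1) (n + 1))⟩, rfl,
      word xs (k - 1) (n + 1), ?_, ?_, ?_⟩, rfl⟩
    · unfold word; simp
    · rw [hs]; exact (sh_mem _ _ _).2 (hy1 (k - 1) (n + 1))
    · have e : k - 1 + ((n + 1 : ℕ) : ℤ) = k + n := by push_cast; ring
      rw [← key k (k - 1) n (n + 1) (by omega) (by push_cast; omega)
        ((sh_mem _ _ _).2 (hy1 (k - 1) (n + 1)))]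
      congr 1
      apply Subtype.ext
      dsimp only
      rw [hs, e]
  have hep : ∀ (k : ℤ) (n : ℕ), ∃ e : EpCan S n, e.val = (V k n, xs (k + n + 1), V k (n + 1)) := by
    intro k n
    have hs := hsp k (n + 1) (k + (n + 1 : ℕ)) rfl
    have e : shiftR (sh (k + (n + 1 : ℕ)) (y k (n + 1))) = sh (k + n) (y k (n + 1)) := by
      funext i
      unfold shiftR sh
      congr 1
      push_cast; ring
    refine ⟨⟨(V k n, xs (k + n + 1), V k (n + 1)), ⟨_, (sh_mem _ _ _).2 (hy1 k (n + 1))⟩, rfl,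
      word xs k (n + 1), ?_, ?_, ?_⟩, rfl⟩
    · unfold word; dsimp only; congr 1; ring
    · rw [hs, e]; exact (sh_mem _ _ _).2 (hy1 k (n + 1))
    · rw [← key k k n (n + 1) le_rfl (by push_cast; omega)
        ((sh_mem _ _ _).2 (hy1 k (n + 1)))]
      congr 1
      apply Subtype.ext
      dsimp only
      rw [hs, e]
  choose EM hEM using hem
  choose EP hEP using hep
  let x : Config (canonicalLGBS S) :=
    { v := V
      em := EM
      ep := EP
      em_s := fun k n => congrArg (fun t => t.1) (hEM k n)
      em_t := fun k n => congrArg (fun t => t.2.2) (hEM k n)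
      ep_s := fun k n => congrArg (fun t => t.1) (hEP k n)
      ep_t := fun k n => congrArg (fun t => t.2.2) (hEP k n)
      label := ⟨xs, fun k n => congrArg (fun t => t.2.1) (hEM k n),
        fun k n => congrArg (fun t => t.2.1) (hEP k n)⟩ }
  have hxs : configSeq x = xs := by
    funext k
    exact congrArg (fun t => t.2.1) (hEM k 0)
  refine ⟨x, hxs, ?_⟩
  ext b
  constructor
  · rintro ⟨k, n, h1, h2⟩
    rw [hxs] at h1
    exact (hV k n b h1).1 h2
  · intro hb
    obtain ⟨k, n, h1⟩ := hT b hb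
    exact ⟨k, n, by rw [hxs]; exact h1, (hV k n b h1).2 hb⟩

theorem seq_shift (x : Config (canonicalLGBS S)) (m : ℤ) :
    configSeq (shiftBy _ m x) = sh m (configSeq x) := rfl

theorem Tset_shift (x : Config (canonicalLGBS S)) (m : ℤ) (b : ℤ → A) :
    sh m b ∈ Tset (shiftBy _ m x) ↔ b ∈ Tset x := by
  have hw : ∀ k n, word (sh m b) k n = word b (k + m) n := by
    intro k n
    funext i
    unfold word sh
    congr 1; ring
  constructor
  · rintro ⟨k, n, h1, h2⟩
    refine ⟨k + m, n, ?_, ?_⟩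
    · intro i hi
      have := h1 (i - m) (by omega)
      simpa [seq_shift, sh] using this
    · rw [hw] at h2; exact h2
  · rintro ⟨k, n, h1, h2⟩
    have e : k - m + m = k := by ring
    refine ⟨k - m, n, ?_, ?_⟩
    · intro i hi
      exact h1 (i + m) (by omega)
    · rw [hw, e]
      show _ ∈ Wv S n (x.v (k - m + m) n)
      rw [e]; exact h2

end GI


namespace GI
set_option linter.unusedSectionVars false

def Agree (N : ℕ) (a a' : ℤ → A) : Prop := ∀ j : ℤ, -N ≤ j → j ≤ N → a' j = a j

theorem open_iff (S : Subshift A) (U : Set {a // a ∈ S.carrier}) :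
    @IsOpen _ (subTop S) U ↔ ∀ a ∈ U, ∃ N : ℕ, ∀ a', Agree N a.val a'.val → a' ∈ U := by
  let _ : TopologicalSpace A := ⊥
  have : DiscreteTopology A := ⟨rfl⟩
  constructor
  · rintro ⟨V, hV, rfl⟩ a ha
    have hV' : IsOpen V := hV
    rw [isOpen_pi_iff] at hV'
    obtain ⟨I, u, h1, h2⟩ := hV' a.val ha
    refine ⟨I.sup Int.natAbs, fun a' h => h2 ?_⟩
    intro i hi
    have := Finset.le_sup (f := Int.natAbs) hi
    rw [h i (by omega) (by omega)]
    exact (h1 i hi).2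
  · intro h
    let _ := subTop S
    refine isOpen_iff_forall_mem_open.2 ?_
    intro a ha
    obtain ⟨N, hN⟩ := h a ha
    refine ⟨{a' | Agree N a.val a'.val}, hN, ?_, fun _ _ _ => rfl⟩
    refine ⟨{b | Agree N a.val b}, ?_, rfl⟩
    have : {b | Agree N a.val b} = Set.pi (Finset.Icc (-N : ℤ) N) (fun i => {a.val i}) := by
      ext b
      simp [Agree, Set.mem_pi]
    rw [this]
    exact isOpen_set_pi (Finset.finite_toSet _) (fun i _ => isOpen_discrete _)

theorem compact_carrier [Fintype A] (S : Subshift A) :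
    @CompactSpace {a // a ∈ S.carrier} (subTop S) := by
  let _ : TopologicalSpace A := ⊥
  have : DiscreteTopology A := ⟨rfl⟩
  have hc : IsClosed S.carrier := S.closed
  exact isCompact_iff_compactSpace.1 hc.isCompact

variable {A₁ A₂ : Type} {S₁ : Subshift A₁} {S₂ : Subshift A₂}

theorem cont_local {f : {a // a ∈ S₁.carrier} → {b // b ∈ S₂.carrier}}
    (hf : @Continuous _ _ (subTop S₁) (subTop S₂) f) (a : {a // a ∈ S₁.carrier}) (i : ℤ) :
    ∃ N : ℕ, ∀ a', Agree N a.val a'.val → (f a').val i = (f a).val i := by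
  have hU : @IsOpen _ (subTop S₂) {b : {b // b ∈ S₂.carrier} | b.val i = (f a).val i} := by
    rw [open_iff]
    intro b hb
    refine ⟨i.natAbs, fun b' h => (h i (by omega) (by omega)).trans hb⟩
  have := (@Continuous.isOpen_preimage _ _ (subTop S₁) (subTop S₂) f hf _ hU)
  rw [open_iff] at this
  exact this a rfl

theorem cont_of_local {f : {a // a ∈ S₁.carrier} → {b // b ∈ S₂.carrier}}
    (h : ∀ a i, ∃ N : ℕ, ∀ a', Agree N a.val a'.val → (f a').val i = (f a).val i) :
    @Continuous _ _ (subTop S₁) (subTop S₂) f := by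
  let _ : TopologicalSpace {a // a ∈ S₁.carrier} := subTop S₁
  let _ : TopologicalSpace A₂ := ⊥
  have : DiscreteTopology A₂ := ⟨rfl⟩
  refine continuous_induced_rng.2 ?_
  refine continuous_pi fun i => ?_
  rw [continuous_def]
  intro s _
  refine (open_iff S₁ _).2 ?_
  intro a ha
  obtain ⟨N, hN⟩ := h a i
  refine ⟨N, fun a' h' => ?_⟩
  show (f a').val i ∈ s
  rw [hN a' h']
  exact ha

theorem uniform_local [Fintype A₁] {f : {a // a ∈ S₁.carrier} → {b // b ∈ S₂.carrier}}
    (hf : @Continuous _ _ (subTop S₁) (subTop S₂) f) (i : ℤ) :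
    ∃ N : ℕ, ∀ a a', Agree N a.val a'.val → (f a').val i = (f a).val i := by
  let _ : TopologicalSpace {a // a ∈ S₁.carrier} := subTop S₁
  have : CompactSpace {a // a ∈ S₁.carrier} := compact_carrier S₁
  let U : ℕ → Set {a // a ∈ S₁.carrier} := fun N =>
    {a | ∀ a', Agree N a.val a'.val → (f a').val i = (f a).val i}
  have hmono : Monotone U := by
    intro N M hNM a ha a' h
    exact ha a' (fun j h1 h2 => h j (by omega) (by omega))
  obtain ⟨N, hN⟩ := isCompact_univ.elim_directed_cover U
    (by
      intro N
      refine (open_iff S₁ _).2 ?_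
      intro a ha
      refine ⟨N, fun a' h a'' h' => ?_⟩
      rw [ha a' h]
      exact ha a'' (fun j h1 h2 => (h' j h1 h2).trans (h j h1 h2)))
    (by
      intro a _
      obtain ⟨N, hN⟩ := cont_local hf a i
      exact Set.mem_iUnion.2 ⟨N, hN⟩)
    (hmono.directed_le)
  exact ⟨N, fun a a' h => hN (Set.mem_univ a) a' h⟩

def shS (S : Subshift A) (m : ℤ) (a : {a // a ∈ S.carrier}) : {a // a ∈ S.carrier} :=
  ⟨sh m a.val, (sh_mem S m a.val).2 a.prop⟩

theorem shS_shS (S : Subshift A) (m n : ℤ) (a : {a // a ∈ S.carrier}) :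
    shS S m (shS S n a) = shS S (m + n) a := Subtype.ext (sh_sh _ _ _)

theorem shS_zero (S : Subshift A) (a : {a // a ∈ S.carrier}) :
    shS S 0 a = a := Subtype.ext (sh_zero _)

theorem chl [Fintype A₁] {f : {a // a ∈ S₁.carrier} → {b // b ∈ S₂.carrier}}
    (hf : @Continuous _ _ (subTop S₁) (subTop S₂) f)
    (he : ∀ m a, f (shS S₁ m a) = shS S₂ m (f a)) :
    ∃ r : ℕ, ∀ (r' : ℕ), r ≤ r' → ∀ a a' (i : ℤ), (∀ j : ℤ, i - r' ≤ j → j ≤ i + r' → a'.val j = a.val j) →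
      (f a').val i = (f a).val i := by
  obtain ⟨r, hr⟩ := uniform_local hf 0
  refine ⟨r, fun r' hr' a a' i h => ?_⟩
  have := hr (shS S₁ i a) (shS S₁ i a') (fun j h1 h2 => h (j + i) (by omega) (by omega))
  rw [he, he] at this
  simpa [shS, sh] using this

/-- A bijective pair of sliding block codes of radius `r`. -/
structure BC (S₁ : Subshift A₁) (S₂ : Subshift A₂) where
  g : {a // a ∈ S₁.carrier} → {b // b ∈ S₂.carrier}
  g' : {b // b ∈ S₂.carrier} → {a // a ∈ S₁.carrier}
  left : ∀ a, g' (g a) = a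
  right : ∀ b, g (g' b) = b
  r : ℕ
  loc : ∀ a a' (i : ℤ), (∀ j : ℤ, i - r ≤ j → j ≤ i + r → a'.val j = a.val j) → (g a').val i = (g a).val i
  loc' : ∀ a a' (i : ℤ), (∀ j : ℤ, i - r ≤ j → j ≤ i + r → a'.val j = a.val j) →
    (g' a').val i = (g' a).val i
  eqv : ∀ m a, g (shS S₁ m a) = shS S₂ m (g a)
  eqv' : ∀ m a, g' (shS S₂ m a) = shS S₁ m (g' a)

def BC.symm (c : BC S₁ S₂) : BC S₂ S₁ := ⟨c.g', c.g, c.right, c.left, c.r, c.loc', c.loc, c.eqv', c.eqv⟩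

theorem eqv_of_shift {f : {a // a ∈ S₁.carrier} → {b // b ∈ S₂.carrier}}
    (h : ∀ a, f (S₁.shiftMap a) = S₂.shiftMap (f a)) :
    ∀ m a, f (shS S₁ m a) = shS S₂ m (f a) := by
  have h1 : ∀ a, f (shS S₁ 1 a) = shS S₂ 1 (f a) := h
  intro m
  induction m using Int.induction_on with
  | zero => intro a; rw [shS_zero, shS_zero]
  | succ i ih =>
    intro a
    rw [← shS_shS, ih, h1, shS_shS]
  | pred i ih =>
    intro a
    have e := ih (shS S₁ (-1) a)
    rw [shS_shS] at e
    have e2 := h1 (shS S₁ (-1) a)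
    rw [shS_shS, add_neg_cancel, shS_zero] at e2
    rw [sub_eq_add_neg, e, e2, shS_shS]
    congr 1
    ring

theorem exists_BC [Fintype A₁] [Fintype A₂] (c : Conjugacy S₁ S₂) :
    ∃ d : BC S₁ S₂, d.g = c.toFun ∧ d.g' = c.invFun := by
  have e1 := eqv_of_shift c.equivariant
  have e2 : ∀ m b, c.invFun (shS S₂ m b) = shS S₁ m (c.invFun b) := by
    intro m b
    apply c.left_inv.injective
    rw [c.right_inv, e1, c.right_inv]
  obtain ⟨r1, h1⟩ := chl c.continuous_toFun e1
  obtain ⟨r2, h2⟩ := chl c.continuous_invFun e2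
  exact ⟨⟨c.toFun, c.invFun, c.left_inv, c.right_inv, max r1 r2, h1 _ (le_max_left _ _),
    h2 _ (le_max_right _ _), e1, e2⟩, rfl, rfl⟩

theorem BC.off (c : BC S₁ S₂) {k : ℤ} {n : ℕ} {a a' : {a // a ∈ S₁.carrier}}
    (h : Off k n a.val a'.val) : Off (k - c.r) (n + 2 * c.r) (c.g a).val (c.g a').val := by
  intro i hi
  apply c.loc
  intro j h1 h2
  apply h
  push_cast at hi
  omega

def BC.img (c : BC S₁ S₂) (T : Set (ℤ → A₁)) : Set (ℤ → A₂) :=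
  {b | ∃ a : {a // a ∈ S₁.carrier}, a.val ∈ T ∧ (c.g a).val = b}

theorem put_in {y : ℤ → A} {k : ℤ} {n : ℕ} {b : ℤ → A} {i : ℤ} (h : k < i ∧ i ≤ k + n) :
    put y k n b i = b i := if_pos h

theorem put_out {y : ℤ → A} {k : ℤ} {n : ℕ} {b : ℤ → A} {i : ℤ} (h : i ≤ k ∨ k + n < i) :
    put y k n b i = y i := if_neg (by omega)

theorem realizes_image (c : BC S₁ S₂) (xs : {a // a ∈ S₁.carrier}) (T : Set (ℤ → A₁))
    (hT : T ⊆ S₁.carrier) (k : ℤ) (n : ℕ) (y : {a // a ∈ S₁.carrier})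
    (hy : Realizes S₁ xs.val T (k - 3 * c.r) (n + 6 * c.r) y.val) :
    Realizes S₂ (c.g xs).val (c.img T) k n (c.g y).val := by
  obtain ⟨-, hy2, hy3⟩ := hy
  have hyx : ∀ i, k - 2 * c.r < i → i ≤ k + n + 2 * c.r → (c.g y).val i = (c.g xs).val i := by
    intro i h1 h2
    apply c.loc
    intro j h3 h4
    apply hy2 <;> push_cast <;> omega
  refine ⟨(c.g y).prop, fun i h1 h2 => hyx i (by omega) (by omega), fun b' hb' => ⟨?_, ?_⟩⟩
  · rintro ⟨b, hbT, hbb⟩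
    subst hbb
    have hb : Off (k - c.r) (n + 2 * c.r) xs.val b.val := by
      have := c.symm.off hb'
      simp only [BC.symm, c.left] at this
      exact this
    have hc := (hy3 b.val (fun i hi => hb i (by push_cast at *; omega))).1 hbT
    have hco : Off (k - c.r) (n + 2 * c.r) y.val (put y.val (k - 3 * c.r) (n + 6 * c.r) b.val) := by
      intro i hi
      by_cases hin : k - 3 * c.r < i ∧ i ≤ k - 3 * c.r + (n + 6 * c.r : ℕ)
      · rw [put_in hin, hb i hi, hy2 i hin.1 hin.2]
      · rw [put_out (by omega)]
    have : put (c.g y).val k n (c.g b).val = (c.g ⟨_, hc⟩).val := by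
      funext i
      by_cases hin : k - 2 * c.r < i ∧ i ≤ k + n + 2 * c.r
      · have e : (c.g ⟨_, hc⟩).val i = (c.g b).val i := by
          apply c.loc
          intro j h1 h2
          apply put_in
          push_cast; omega
        rw [e]
        by_cases hin2 : k < i ∧ i ≤ k + n
        · rw [put_in hin2]
        · rw [put_out (by omega), hb' i (by omega), hyx i hin.1 hin.2]
      · have e : (c.g ⟨_, hc⟩).val i = (c.g y).val i := by
          apply c.loc
          intro j h1 h2
          apply hco
          push_cast; omega
        rw [e, put_out (by omega)]
    rw [this]
    exact (c.g _).prop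
  · intro hd
    let d : {b // b ∈ S₂.carrier} := ⟨_, hd⟩
    have hcy : Off (k - c.r) (n + 2 * c.r) y.val (c.g' d).val := by
      have h0 : Off k n (c.g y).val d.val := fun i hi => put_out hi
      have := c.symm.off h0
      simp only [BC.symm, c.left] at this
      exact this
    have hb0 : Off (k - 3 * c.r) (n + 6 * c.r) xs.val
      (put xs.val (k - 3 * c.r) (n + 6 * c.r) (c.g' d).val) := fun i hi => put_out hi
    have hpp : put y.val (k - 3 * c.r) (n + 6 * c.r)
        (put xs.val (k - 3 * c.r) (n + 6 * c.r) (c.g' d).val) = (c.g' d).val := by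
      funext i
      by_cases hin : k - 3 * c.r < i ∧ i ≤ k - 3 * c.r + (n + 6 * c.r : ℕ)
      · rw [put_in hin, put_in hin]
      · rw [put_out (by omega), hcy i (by push_cast at *; omega)]
    have hbT := (hy3 _ hb0).2 (by rw [hpp]; exact (c.g' d).prop)
    have hbo : Off (k - c.r) (n + 2 * c.r) xs.val
        (put xs.val (k - 3 * c.r) (n + 6 * c.r) (c.g' d).val) := by
      intro i hi
      by_cases hin : k - 3 * c.r < i ∧ i ≤ k - 3 * c.r + (n + 6 * c.r : ℕ)
      · rw [put_in hin, hcy i hi, hy2 i hin.1 hin.2]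
      · rw [put_out (by omega)]
    refine ⟨⟨_, hT hbT⟩, hbT, ?_⟩
    funext i
    by_cases hin : k - 2 * c.r < i ∧ i ≤ k + n + 2 * c.r
    · have e : (c.g ⟨_, hT hbT⟩).val i = (c.g (c.g' d)).val i := by
        apply c.loc
        intro j h1 h2
        apply put_in
        push_cast; omega
      rw [e, c.right]
      by_cases hin2 : k < i ∧ i ≤ k + n
      · exact put_in hin2
      · rw [hb' i (by omega), ← hyx i hin.1 hin.2]
        exact put_out (by omega)
    · have e : (c.g ⟨_, hT hbT⟩).val i = (c.g xs).val i := by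
        apply c.loc
        intro j h1 h2
        apply hbo
        push_cast; omega
      rw [e, hb' i (by omega)]

variable [Fintype A] [Fintype A₁] [Fintype A₂] {S : Subshift A}

noncomputable def seqS (x : Config (canonicalLGBS S)) : {a // a ∈ S.carrier} := ⟨configSeq x, seq_mem x⟩

theorem exists_lift (c : BC S₁ S₂) (x : Config (canonicalLGBS S₁)) :
    ∃ x' : Config (canonicalLGBS S₂), configSeq x' = (c.g (seqS x)).val ∧
      Tset x' = c.img (Tset x) := by
  apply exists_config
  · intro k n
    obtain ⟨y, hy⟩ := exists_realizes x (k - 3 * c.r) (n + 6 * c.r)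
    exact ⟨_, realizes_image c (seqS x) (Tset x) (Tset_sub x) k n ⟨y, hy.1⟩ hy⟩
  · rintro b ⟨a, ⟨k, n, h1, h2⟩, rfl⟩
    exact ⟨_, _, c.off (a := seqS x) h1⟩

noncomputable def lift (c : BC S₁ S₂) (x : Config (canonicalLGBS S₁)) : Config (canonicalLGBS S₂) :=
  (exists_lift c x).choose

theorem seq_lift (c : BC S₁ S₂) (x : Config (canonicalLGBS S₁)) :
    configSeq (lift c x) = (c.g (seqS x)).val := (exists_lift c x).choose_spec.1

theorem seqS_lift (c : BC S₁ S₂) (x : Config (canonicalLGBS S₁)) :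
    seqS (lift c x) = c.g (seqS x) := Subtype.ext (seq_lift c x)

theorem Tset_lift (c : BC S₁ S₂) (x : Config (canonicalLGBS S₁)) :
    Tset (lift c x) = c.img (Tset x) := (exists_lift c x).choose_spec.2

theorem lift_symm (c : BC S₁ S₂) (x : Config (canonicalLGBS S₁)) :
    lift c.symm (lift c x) = x := by
  apply ext_ST
  · rw [seq_lift, seqS_lift]
    show (c.g' (c.g _)).val = _
    rw [c.left]; rfl
  · rw [Tset_lift, Tset_lift]
    ext b
    constructor
    · rintro ⟨a, ⟨a', h1, h2⟩, h3⟩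
      have : c.g a' = a := Subtype.ext h2
      subst this
      change (c.g' (c.g a')).val = b at h3
      rw [c.left] at h3
      rw [← h3]; exact h1
    · intro hb
      refine ⟨c.g ⟨b, Tset_sub x hb⟩, ⟨_, hb, rfl⟩, ?_⟩
      show (c.g' (c.g _)).val = b
      rw [c.left]

theorem lift_shift (c : BC S₁ S₂) (m : ℤ) (x : Config (canonicalLGBS S₁)) :
    lift c (shiftBy _ m x) = shiftBy _ m (lift c x) := by
  apply ext_ST
  · rw [seq_lift, seq_shift, seq_lift]
    have : seqS (shiftBy _ m x) = shS S₁ m (seqS x) := rfl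
    rw [this, c.eqv]; rfl
  · ext b
    obtain ⟨b, rfl⟩ : ∃ b', b = sh m b' := ⟨sh (-m) b, by rw [sh_sh, add_neg_cancel, sh_zero]⟩
    rw [Tset_shift, Tset_lift, Tset_lift]
    constructor
    · rintro ⟨a, h1, h2⟩
      refine ⟨shS S₁ (-m) a, ?_, ?_⟩
      · rw [← Tset_shift x m]
        convert h1 using 1
        show sh m (sh (-m) a.val) = _
        rw [sh_sh, add_neg_cancel, sh_zero]
      · rw [c.eqv]
        show sh (-m) (c.g a).val = b
        rw [h2, sh_sh, neg_add_cancel, sh_zero]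
    · rintro ⟨a, h1, h2⟩
      refine ⟨shS S₁ m a, (Tset_shift x m _).2 h1, ?_⟩
      rw [c.eqv]
      show sh m (c.g a).val = _
      rw [h2]

theorem rect_lift (c : BC S₁ S₂) (x z : Config (canonicalLGBS S₁)) (p q : ℤ) (hpq : p < q)
    (h : RectEq x z p q) : RectEq (lift c x) (lift c z) (p - c.r) (q + c.r) := by
  rw [rectEq_iff _ _ _ _ hpq] at h
  rw [rectEq_iff _ _ _ _ (by omega), Tset_lift, Tset_lift, h.1]
  refine ⟨rfl, fun i hi => ?_⟩
  rw [seq_lift, seq_lift]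
  apply c.loc
  intro j h1 h2
  exact h.2 j (by omega)

theorem Pword_eq_iff (x z : Config (canonicalLGBS S)) (k : ℤ) (n : ℕ) :
    Pword x k n = Pword z k n ↔ ∀ i, k < i → i ≤ k + n → configSeq x i = configSeq z i := by
  induction n with
  | zero =>
    simp only [Pword, true_iff]
    intro i h1 h2; push_cast at h2; omega
  | succ n ih =>
    unfold Pword
    rw [lp_eq, lp_eq]
    constructor
    · intro h
      obtain ⟨h1, h2⟩ := List.append_inj' h rfl
      intro i a1 a2
      by_cases hi : i ≤ k + n
      · exact ih.1 h1 i a1 hi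
      · have : i = k + n + 1 := by push_cast at a2; omega
        subst this
        simpa using h2
    · intro h
      rw [ih.2 (fun i a1 a2 => h i a1 (by push_cast; omega)), h (k + n + 1) (by omega) (by push_cast; omega)]

theorem Pword_mem (x : Config (canonicalLGBS S)) (k : ℤ) (n : ℕ) :
    Pword x k n ∈ (canonicalLGBS S).Pset n (x.v k n) := by
  induction n with
  | zero => exact Set.mem_singleton _
  | succ n ih =>
    refine ⟨x.ep k n, x.ep_t k n, Pword x k n, ?_, rfl⟩
    rw [x.ep_s]; exact ih

theorem cyl_open (x : Config (canonicalLGBS S)) (k : ℤ) (n : ℕ) :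
    IsOpen (Cyl k n (x.v k n) (Pword x k n)) :=
  TopologicalSpace.isOpen_generateFrom_of_mem ⟨k, n, _, _, Pword_mem x k n, rfl⟩

theorem lift_cont (c : BC S₁ S₂) : Continuous (lift c) := by
  refine continuous_generateFrom_iff.2 ?_
  rintro U ⟨k, n, v, μ, -, rfl⟩
  rw [isOpen_iff_forall_mem_open]
  rintro x ⟨rfl, rfl⟩
  refine ⟨_, ?_, cyl_open x (k - 3 * c.r) (n + 6 * c.r), rfl, rfl⟩
  rintro z ⟨hv, hw⟩
  rw [Pword_eq_iff] at hw
  have hwl : ∀ i, k < i → i ≤ k + n → configSeq (lift c z) i = configSeq (lift c x) i := by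
    intro i h1 h2
    rw [seq_lift, seq_lift]
    apply c.loc
    intro j h3 h4
    exact hw j (by omega) (by push_cast; omega)
  refine ⟨?_, (Pword_eq_iff _ _ _ _).2 hwl⟩
  obtain ⟨y, hy⟩ := exists_realizes x (k - 3 * c.r) (n + 6 * c.r)
  have hyS := hy.1
  have hy' : Realizes S₁ (configSeq z) (Tset z) (k - 3 * c.r) (n + 6 * c.r) y := by
    rw [realizes_iff z _ _ _ ((sh_mem _ _ _).2 hyS)
      (fun i h1 h2 => (hy.2.1 i h1 h2).trans (hw i h1 h2).symm)]
    rw [hv]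
    exact (realizes_iff x _ _ _ _ hy.2.1).1 hy
  have r1 := realizes_image c (seqS x) (Tset x) (Tset_sub x) k n ⟨y, hyS⟩ hy
  have r2 := realizes_image c (seqS z) (Tset z) (Tset_sub z) k n ⟨y, hyS⟩ hy'
  rw [← seq_lift, ← Tset_lift] at r1 r2
  rw [(realizes_iff (lift c z) k n _ ((sh_mem _ _ _).2 (c.g _).prop) r2.2.1).1 r2,
    (realizes_iff (lift c x) k n _ ((sh_mem _ _ _).2 (c.g _).prop) r1.2.1).1 r1]

noncomputable def Rlift (c : BC S₁ S₂) (y : ↥(Rset (canonicalLGBS S₁))) : ↥(Rset (canonicalLGBS S₂)) :=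
  ⟨(lift c y.val.1, lift c y.val.2), by
    obtain ⟨p, q, h, h'⟩ := y.prop
    exact ⟨p - c.r, q + c.r, by omega, rect_lift c _ _ p q h h'⟩⟩

theorem inclPQ_cont (L : LambdaGraphBisystem A) (p q : ℤ) (h : p < q) :
    @Continuous _ _ inferInstance (indTop L) (inclPQ L p q h) := by
  unfold indTop
  refine continuous_iSup_rng (i := p) ?_
  refine continuous_iSup_rng (i := q) ?_
  refine continuous_iSup_rng (i := h) ?_
  exact continuous_coinduced_rng

theorem Rlift_cont (c : BC S₁ S₂) :
    @Continuous _ _ (indTop (canonicalLGBS S₁)) (indTop (canonicalLGBS S₂)) (Rlift c) := by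
  let _ := indTop (canonicalLGBS S₂)
  rw [indTop]
  refine continuous_iSup_dom.2 fun p => continuous_iSup_dom.2 fun q =>
    continuous_iSup_dom.2 fun h => continuous_coinduced_dom.2 ?_
  have hpq : p - c.r < q + c.r := by omega
  let F : ↥(RpqSet (canonicalLGBS S₁) p q) → ↥(RpqSet (canonicalLGBS S₂) (p - c.r) (q + c.r)) :=
    fun y => ⟨(lift c y.val.1, lift c y.val.2), rect_lift c _ _ p q h y.prop⟩
  have hF : Continuous F := by
    refine Continuous.subtype_mk ?_ _
    exact ((lift_cont c).comp (continuous_fst.comp continuous_subtype_val)).prodMk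
      ((lift_cont c).comp (continuous_snd.comp continuous_subtype_val))
  exact (inclPQ_cont (canonicalLGBS S₂) _ _ hpq).comp hF

noncomputable def phi (c : BC S₁ S₂) (g : ↥(GLset (canonicalLGBS S₁))) :
    ↥(GLset (canonicalLGBS S₂)) :=
  ⟨(lift c g.val.1, g.val.2.1, lift c g.val.2.2), by
    have := (Rlift c ⟨_, g.prop⟩).prop
    show (shiftBy _ g.val.2.1 (lift c g.val.1), lift c g.val.2.2) ∈ Rset _
    rw [← lift_shift]; exact this⟩

theorem phi_cont (c : BC S₁ S₂) :
    @Continuous _ _ (GLtop (canonicalLGBS S₁)) (GLtop (canonicalLGBS S₂)) (phi c) := by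
  let _ := indTop (canonicalLGBS S₂)
  let _ := indTop (canonicalLGBS S₁)
  let _ := GLtop (canonicalLGBS S₁)
  refine continuous_induced_rng.2 ?_
  have e : GLmap (canonicalLGBS S₂) ∘ phi c =
      (fun t : ↥(Rset (canonicalLGBS S₁)) × ℤ => (Rlift c t.1, t.2)) ∘ GLmap (canonicalLGBS S₁) := by
    funext g
    refine Prod.ext (Subtype.ext (Prod.ext ?_ rfl)) rfl
    exact (lift_shift c _ _).symm
  rw [e]
  refine Continuous.comp ?_ continuous_induced_dom
  exact ((Rlift_cont c).comp continuous_fst).prodMk continuous_snd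

theorem phi_symm (c : BC S₁ S₂) (g : ↥(GLset (canonicalLGBS S₁))) : phi c.symm (phi c g) = g := by
  apply Subtype.ext
  exact Prod.ext (lift_symm c _) (Prod.ext rfl (lift_symm c _))

theorem forward (c : Conjugacy S₁ S₂) :
    ∃ (hΛ : {a // a ∈ S₁.carrier} → {b // b ∈ S₂.carrier})
      (φ : ↥(GLset (canonicalLGBS S₁)) → ↥(GLset (canonicalLGBS S₂)))
      (h : Config (canonicalLGBS S₁) → Config (canonicalLGBS S₂)),
      @IsHomeomorph _ _ (subTop S₁) (subTop S₂) hΛ ∧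
      @IsHomeomorph _ _ (GLtop (canonicalLGBS S₁)) (GLtop (canonicalLGBS S₂)) φ ∧
      (∀ g, (φ g).val.2.1 = g.val.2.1) ∧
      (∀ (x : Config (canonicalLGBS S₁)) (hx : (x, (0 : ℤ), x) ∈ GLset (canonicalLGBS S₁)),
        (φ ⟨(x, 0, x), hx⟩).val = (h x, 0, h x)) ∧
      (∀ g g' gg : ↥(GLset (canonicalLGBS S₁)), g.val.2.2 = g'.val.1 →
        gg.val = (g.val.1, g.val.2.1 + g'.val.2.1, g'.val.2.2) →
        (φ gg).val = ((φ g).val.1, (φ g).val.2.1 + (φ g').val.2.1, (φ g').val.2.2)) ∧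
      (φ '' {g | g.val.2.1 = 0} = {g | g.val.2.1 = 0}) ∧
      (φ '' {g | g.val.2.1 = 0 ∧ g.val.1 = g.val.2.2} =
        {g | g.val.2.1 = 0 ∧ g.val.1 = g.val.2.2}) ∧
      (∀ x : Config (canonicalLGBS S₁), ∃ hx : configSeq x ∈ S₁.carrier,
        (hΛ ⟨configSeq x, hx⟩).val = configSeq (h x)) := by
  obtain ⟨d, hd1, hd2⟩ := exists_BC c
  have ps : ∀ g, phi d (phi d.symm g) = g := fun g => phi_symm d.symm g
  refine ⟨c.toFun, phi d, lift d, ?_, ?_, fun g => rfl, fun x hx => rfl, ?_, ?_, ?_, ?_⟩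
  · let _ := subTop S₁
    let _ := subTop S₂
    exact isHomeomorph_iff_exists_inverse.2 ⟨c.continuous_toFun, c.invFun, c.left_inv, c.right_inv,
      c.continuous_invFun⟩
  · let _ := GLtop (canonicalLGBS S₁)
    let _ := GLtop (canonicalLGBS S₂)
    exact isHomeomorph_iff_exists_inverse.2 ⟨phi_cont d, phi d.symm, phi_symm d, ps, phi_cont d.symm⟩
  · intro g g' gg _ h2
    show (lift d gg.val.1, gg.val.2.1, lift d gg.val.2.2) = _
    rw [h2]; rfl
  · ext g
    constructor
    · rintro ⟨g, hg, rfl⟩; exact hg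
    · intro hg; exact ⟨phi d.symm g, hg, ps g⟩
  · ext g
    constructor
    · rintro ⟨g, hg, rfl⟩; exact ⟨hg.1, congrArg (lift d) hg.2⟩
    · intro hg; exact ⟨phi d.symm g, ⟨hg.1, congrArg (lift d.symm) hg.2⟩, ps g⟩
  · intro x
    refine ⟨seq_mem x, ?_⟩
    rw [seq_lift, hd1]; rfl

end GI


namespace GI
set_option linter.unusedSectionVars false

variable {A₁ A₂ : Type} {S₁ : Subshift A₁} {S₂ : Subshift A₂}

theorem exists_limit [Fintype A₂] (G : {a // a ∈ S₁.carrier} → {b // b ∈ S₂.carrier})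
    (hG : @Continuous _ _ (subTop S₁) (subTop S₂) G) (N : ℕ)
    (hN : ∀ a (i : ℤ), N < i → (G (shS S₁ 1 a)).val i = (G a).val (i + 1)) :
    ∃ Φ : {a // a ∈ S₁.carrier} → {b // b ∈ S₂.carrier},
      @Continuous _ _ (subTop S₁) (subTop S₂) Φ ∧
      (∀ m a, Φ (shS S₁ m a) = shS S₂ m (Φ a)) ∧
      ∀ a (i : ℤ), N < i → (Φ a).val i = (G a).val i := by
  have hit : ∀ (m : ℕ) a (i : ℤ), N < i → (G (shS S₁ m a)).val i = (G a).val (i + m) := by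
    intro m
    induction m with
    | zero => intro a i _; simp [shS_zero]
    | succ m ih =>
      intro a i hi
      have e : shS S₁ ((m + 1 : ℕ) : ℤ) a = shS S₁ 1 (shS S₁ m a) := by
        rw [shS_shS]; congr 1; push_cast; ring
      rw [e, hN _ i hi, ih _ _ (by omega)]
      congr 1
      push_cast; ring
  let F : {a // a ∈ S₁.carrier} → ℤ → A₂ := fun a i => (G (shS S₁ (i - N - 1) a)).val (N + 1)
  have hFs : ∀ m a i, F (shS S₁ m a) i = F a (i + m) := by
    intro m a i
    show (G _).val _ = (G _).val _
    rw [shS_shS]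
    congr 4
    ring
  have hFG : ∀ a (i : ℤ), N < i → F a i = (G a).val i := by
    intro a i hi
    have := hit (i - N - 1).toNat a (N + 1) (by omega)
    have e : ((i - N - 1).toNat : ℤ) = i - N - 1 := by omega
    rw [e] at this
    show (G _).val _ = _
    rw [this]
    congr 1
    ring
  have hmem : ∀ a, F a ∈ S₂.carrier := by
    intro a
    apply mem_of_approx
    intro M
    let K : ℤ := N + M + 1
    refine ⟨sh K (G (shS S₁ (-K) a)).val, (sh_mem _ _ _).2 (G _).prop, fun i h1 h2 => ?_⟩
    show (G (shS S₁ (-K) a)).val (i + K) = _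
    rw [← hFG _ _ (by omega), hFs]
    congr 1
    ring
  refine ⟨fun a => ⟨F a, hmem a⟩, ?_, ?_, hFG⟩
  · apply cont_of_local
    intro a i
    obtain ⟨M, hM⟩ := cont_local hG (shS S₁ (i - N - 1) a) (N + 1)
    refine ⟨M + (i - N - 1).natAbs, fun a' h => ?_⟩
    apply hM
    intro j h1 h2
    apply h <;> omega
  · intro m a
    apply Subtype.ext
    funext i
    exact hFs m a i

theorem half [Fintype A₂] (G : {a // a ∈ S₁.carrier} → {b // b ∈ S₂.carrier})
    (H : {b // b ∈ S₂.carrier} → {a // a ∈ S₁.carrier})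
    (hHG : ∀ a, H (G a) = a)
    (Φ : {a // a ∈ S₁.carrier} → {b // b ∈ S₂.carrier})
    (Ψ : {b // b ∈ S₂.carrier} → {a // a ∈ S₁.carrier})
    (hΨ : @Continuous _ _ (subTop S₂) (subTop S₁) Ψ)
    (eΦ : ∀ m a, Φ (shS S₁ m a) = shS S₂ m (Φ a))
    (eΨ : ∀ m a, Ψ (shS S₂ m a) = shS S₁ m (Ψ a)) (N M : ℕ)
    (hN : ∀ a (i : ℤ), N < i → (Φ a).val i = (G a).val i)
    (hM : ∀ a (i : ℤ), M < i → (Ψ a).val i = (H a).val i) (a) : Ψ (Φ a) = a := by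
  obtain ⟨r, hr⟩ := chl hΨ eΨ
  let K : ℤ := N + M + r + 1
  have key : ∀ a, (Ψ (Φ a)).val K = a.val K := by
    intro a
    rw [hr r le_rfl (G a) (Φ a) K (fun j h1 h2 => hN a j (by omega)), hM _ _ (by omega), hHG]
  apply Subtype.ext
  funext j
  have := key (shS S₁ (j - K) a)
  rw [eΦ, eΨ] at this
  change (Ψ (Φ a)).val (K + (j - K)) = a.val (K + (j - K)) at this
  simpa using this

theorem conj_of_eventual [Fintype A₁] [Fintype A₂]
    (G : {a // a ∈ S₁.carrier} → {b // b ∈ S₂.carrier})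
    (H : {b // b ∈ S₂.carrier} → {a // a ∈ S₁.carrier})
    (hHG : ∀ a, H (G a) = a) (hGH : ∀ b, G (H b) = b)
    (hG : @Continuous _ _ (subTop S₁) (subTop S₂) G)
    (hH : @Continuous _ _ (subTop S₂) (subTop S₁) H) (N M : ℕ)
    (hN : ∀ a (i : ℤ), N < i → (G (shS S₁ 1 a)).val i = (G a).val (i + 1))
    (hM : ∀ a (i : ℤ), M < i → (H (shS S₂ 1 a)).val i = (H a).val (i + 1)) :
    Nonempty (Conjugacy S₁ S₂) := by
  obtain ⟨Φ, c1, e1, l1⟩ := exists_limit G hG N hN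
  obtain ⟨Ψ, c2, e2, l2⟩ := exists_limit H hH M hM
  exact ⟨⟨Φ, Ψ, half G H hHG Φ Ψ c2 e1 e2 N M l1 l2, half H G hGH Ψ Φ c1 e2 e1 M N l2 l1, c1, c2,
    fun a => e1 1 a⟩⟩

variable [Fintype A] [Fintype A₁] [Fintype A₂] {S : Subshift A}

theorem config_compact (S : Subshift A) : CompactSpace (Config (canonicalLGBS S)) := by
  let L := canonicalLGBS S
  let _ : ∀ n, TopologicalSpace (L.V n) := fun _ => ⊥
  have : ∀ n, DiscreteTopology (L.V n) := fun _ => ⟨rfl⟩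
  let _ : ∀ n, TopologicalSpace (L.Em n) := fun _ => ⊥
  have : ∀ n, DiscreteTopology (L.Em n) := fun _ => ⟨rfl⟩
  let _ : ∀ n, TopologicalSpace (L.Ep n) := fun _ => ⊥
  have : ∀ n, DiscreteTopology (L.Ep n) := fun _ => ⟨rfl⟩
  have : ∀ n, Finite (L.V n) := fun n => @Finite.of_fintype _ (L.fintypeV n)
  have : ∀ n, Finite (L.Em n) := fun n => @Finite.of_fintype _ (L.fintypeEm n)
  have : ∀ n, Finite (L.Ep n) := fun n => @Finite.of_fintype _ (L.fintypeEp n)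
  let _ : TopologicalSpace A := ⊥
  have : DiscreteTopology A := ⟨rfl⟩
  let _ : TopologicalSpace (List A) := ⊥
  have : DiscreteTopology (List A) := ⟨rfl⟩
  let P := (ℤ → ∀ n : ℕ, L.V n) × (ℤ → ∀ n : ℕ, L.Em n) × (ℤ → ∀ n : ℕ, L.Ep n) × (ℤ → A)
  have cv : ∀ k n, Continuous (fun t : P => t.1 k n) := fun k n =>
    (continuous_apply n).comp ((continuous_apply k).comp continuous_fst)
  have cm : ∀ k n, Continuous (fun t : P => t.2.1 k n) := fun k n =>
    (continuous_apply n).comp ((continuous_apply k).comp (continuous_fst.comp continuous_snd))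
  have cp : ∀ k n, Continuous (fun t : P => t.2.2.1 k n) := fun k n =>
    (continuous_apply n).comp ((continuous_apply k).comp
      (continuous_fst.comp (continuous_snd.comp continuous_snd)))
  have cx : ∀ k, Continuous (fun t : P => t.2.2.2 k) := fun k =>
    (continuous_apply k).comp (continuous_snd.comp (continuous_snd.comp continuous_snd))
  let K : Set P := {t | ∀ (k : ℤ) (n : ℕ),
    L.sm n (t.2.1 k n) = t.1 (k - 1) (n + 1) ∧ L.tm n (t.2.1 k n) = t.1 k n ∧
    L.sp n (t.2.2.1 k n) = t.1 k n ∧ L.tp n (t.2.2.1 k n) = t.1 k (n + 1) ∧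
    L.lm n (t.2.1 k n) = t.2.2.2 k ∧ L.lp n (t.2.2.1 k n) = t.2.2.2 (k + n + 1)}
  have dc : ∀ {X Y : Type} [TopologicalSpace X] [DiscreteTopology X] [TopologicalSpace Y]
    (f : X → Y), Continuous f := fun f => continuous_of_discreteTopology
  have hK : IsClosed K := by
    have : K = ⋂ (k : ℤ), ⋂ (n : ℕ), {t | 
      L.sm n (t.2.1 k n) = t.1 (k - 1) (n + 1) ∧ L.tm n (t.2.1 k n) = t.1 k n ∧
      L.sp n (t.2.2.1 k n) = t.1 k n ∧ L.tp n (t.2.2.1 k n) = t.1 k (n + 1) ∧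
      L.lm n (t.2.1 k n) = t.2.2.2 k ∧ L.lp n (t.2.2.1 k n) = t.2.2.2 (k + n + 1)} := by
      ext t; simp only [K, Set.mem_setOf_eq, Set.mem_iInter]
    rw [this]
    refine isClosed_iInter fun k => isClosed_iInter fun n => ?_
    refine (isClosed_eq ((dc (L.sm n)).comp (cm k n)) (cv _ _)).inter ?_
    refine (isClosed_eq ((dc (L.tm n)).comp (cm k n)) (cv _ _)).inter ?_
    refine (isClosed_eq ((dc (L.sp n)).comp (cp k n)) (cv _ _)).inter ?_
    refine (isClosed_eq ((dc (L.tp n)).comp (cp k n)) (cv _ _)).inter ?_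
    refine (isClosed_eq ((dc (L.lm n)).comp (cm k n)) (cx _)).inter ?_
    exact isClosed_eq ((dc (L.lp n)).comp (cp k n)) (cx _)
  have : CompactSpace K := isCompact_iff_compactSpace.1 hK.isCompact
  let mk : K → Config L := fun t =>
    { v := t.val.1
      em := t.val.2.1
      ep := t.val.2.2.1
      em_s := fun k n => (t.prop k n).1
      em_t := fun k n => (t.prop k n).2.1
      ep_s := fun k n => (t.prop k n).2.2.1
      ep_t := fun k n => (t.prop k n).2.2.2.1
      label := ⟨t.val.2.2.2, fun k n => (t.prop k n).2.2.2.2.1, fun k n => (t.prop k n).2.2.2.2.2⟩ }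
  have hmk : Continuous mk := by
    refine continuous_generateFrom_iff.2 ?_
    rintro U ⟨k, n, v, μ, -, rfl⟩
    have h1 : Continuous (fun t : K => t.val.1 k n) := (cv k n).comp continuous_subtype_val
    have h2 : ∀ n, Continuous (fun t : K => Pword (mk t) k n) := by
      intro n
      induction n with
      | zero => exact continuous_const
      | succ n ih =>
        have h3 : Continuous (fun t : K => t.val.2.2.1 k n) := (cp k n).comp continuous_subtype_val
        exact (dc (fun s : List A × L.Ep n => s.1 ++ [L.lp n s.2])).comp (ih.prodMk h3)
    exact ((isOpen_discrete {v}).preimage h1).inter ((isOpen_discrete {μ}).preimage (h2 n))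
  have hsurj : Function.Surjective mk := by
    intro x
    refine ⟨⟨(x.v, x.em, x.ep, configSeq x), fun k n => ⟨x.em_s k n, x.em_t k n, x.ep_s k n,
      x.ep_t k n, lm_eq x k n, lp_eq x k n⟩⟩, ?_⟩
    exact config_ext _ _ rfl rfl rfl
  exact hsurj.compactSpace hmk

theorem seq_open (i : ℤ) :
    IsOpen {y : Config (canonicalLGBS S) × Config (canonicalLGBS S) |
      configSeq y.1 i = configSeq y.2 i} := by
  let _ : TopologicalSpace A := ⊥
  have : DiscreteTopology A := ⟨rfl⟩
  have hc : Continuous (fun x : Config (canonicalLGBS S) => configSeq x i) := by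
    rw [continuous_def]
    intro s _
    rw [isOpen_iff_forall_mem_open]
    intro x hx
    refine ⟨_, ?_, cyl_open x (i - 1) 1, rfl, rfl⟩
    rintro z ⟨-, hz⟩
    rw [Pword_eq_iff] at hz
    show configSeq z i ∈ s
    rw [hz i (by omega) (by push_cast; omega)]
    exact hx
  exact (isOpen_discrete {p : A × A | p.1 = p.2}).preimage
    ((hc.comp continuous_fst).prodMk (hc.comp continuous_snd))

theorem uniform_R {Y : Type} [TopologicalSpace Y] [CompactSpace Y]
    (f : Y → ↥(Rset (canonicalLGBS S))) (hf : @Continuous _ _ _ (indTop (canonicalLGBS S)) f) :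
    ∃ N : ℕ, ∀ y (i : ℤ), N < i → configSeq (f y).val.1 i = configSeq (f y).val.2 i := by
  let U : ℕ → Set ↥(Rset (canonicalLGBS S)) := fun N =>
    {y | ∀ i : ℤ, N < i → configSeq y.val.1 i = configSeq y.val.2 i}
  have hU : ∀ N, @IsOpen _ (indTop (canonicalLGBS S)) (U N) := by
    intro N
    unfold indTop
    rw [isOpen_iSup_iff]; intro p
    rw [isOpen_iSup_iff]; intro q
    rw [isOpen_iSup_iff]; intro h
    rw [isOpen_coinduced]
    have : inclPQ (canonicalLGBS S) p q h ⁻¹' U N =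
        ⋂ i ∈ Finset.Ioo (N : ℤ) q, Subtype.val ⁻¹' {y | configSeq y.1 i = configSeq y.2 i} := by
      ext y
      simp only [Set.mem_iInter, Finset.mem_Ioo, Set.mem_preimage, U, Set.mem_setOf_eq, inclPQ]
      constructor
      · intro h' i hi; exact h' i hi.1
      · intro h' i hi
        by_cases hq : i < q
        · exact h' i ⟨hi, hq⟩
        · exact ((rectEq_iff _ _ p q h).1 y.prop).2 i (by omega)
    rw [this]
    exact isOpen_biInter_finset fun i _ => (seq_open i).preimage continuous_subtype_val
  let _ := indTop (canonicalLGBS S)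
  obtain ⟨N, hN⟩ := isCompact_univ.elim_directed_cover (fun N => f ⁻¹' U N)
    (fun N => (hU N).preimage hf)
    (by
      intro y _
      obtain ⟨p, q, h, h'⟩ := (f y).prop
      refine Set.mem_iUnion.2 ⟨q.natAbs, fun i hi => ?_⟩
      exact ((rectEq_iff _ _ p q h).1 h').2 i (by omega))
    (Monotone.directed_le (by
      intro N M hNM y hy i hi
      exact hy i (by omega)))
  exact ⟨N, fun y i hi => hN (Set.mem_univ y) i hi⟩

theorem rel_refl (x : Config (canonicalLGBS S)) : (x, x) ∈ Rset (canonicalLGBS S) :=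
  ⟨0, 1, by norm_num, fun _ _ _ _ => ⟨rfl, rfl, rfl⟩⟩

theorem shift_zero (x : Config (canonicalLGBS S)) : shiftBy _ 0 x = x := by
  apply config_ext
  · funext k n; show x.v (k + 0) n = _; rw [add_zero]
  · funext k n; show x.em (k + 0) n = _; rw [add_zero]
  · funext k n; show x.ep (k + 0) n = _; rw [add_zero]

noncomputable def gen (S : Subshift A) (x : Config (canonicalLGBS S)) : ↥(GLset (canonicalLGBS S)) :=
  ⟨(x, 1, shiftBy _ 1 x), rel_refl _⟩

theorem shift_cont (m : ℤ) : Continuous (shiftBy (canonicalLGBS S) m) := by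
  refine continuous_generateFrom_iff.2 ?_
  rintro U ⟨k, n, v, μ, -, rfl⟩
  rw [isOpen_iff_forall_mem_open]
  rintro x ⟨rfl, rfl⟩
  refine ⟨_, ?_, cyl_open x (k + m) n, rfl, rfl⟩
  rintro z ⟨hv, hw⟩
  refine ⟨hv, ?_⟩
  rw [Pword_eq_iff] at hw ⊢
  intro i h1 h2
  exact hw (i + m) (by omega) (by omega)

theorem gen_cont (S : Subshift A) : @Continuous _ _ _ (GLtop (canonicalLGBS S)) (gen S) := by
  let _ := indTop (canonicalLGBS S)
  refine continuous_induced_rng.2 ?_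
  have h1 : Continuous (fun x : Config (canonicalLGBS S) =>
      (⟨(shiftBy _ 1 x, shiftBy _ 1 x), fun _ _ _ _ => ⟨rfl, rfl, rfl⟩⟩ :
        ↥(RpqSet (canonicalLGBS S) 0 1))) :=
    Continuous.subtype_mk ((shift_cont 1).prodMk (shift_cont 1)) _
  have h2 := (inclPQ_cont (canonicalLGBS S) 0 1 (by norm_num)).comp h1
  exact h2.prodMk continuous_const

theorem GLmap_cont (S : Subshift A) : @Continuous _ _ (GLtop (canonicalLGBS S))
    (indTop (canonicalLGBS S)) (fun g => (GLmap (canonicalLGBS S) g).1) := by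
  let _ := indTop (canonicalLGBS S)
  let _ := GLtop (canonicalLGBS S)
  exact continuous_fst.comp (continuous_induced_dom (f := GLmap (canonicalLGBS S)))

theorem exists_preimage (S : Subshift A) (a : {a // a ∈ S.carrier}) :
    ∃ x : Config (canonicalLGBS S), seqS x = a := by
  obtain ⟨x, h1, -⟩ := exists_config S a.val {b | b ∈ S.carrier ∧ ∃ k n, Off k n a.val b}
    (by
      intro k n
      refine ⟨a.val, a.prop, fun _ _ _ => rfl, fun b hb => ?_⟩
      have : put a.val k n b = b := by
        funext i
        by_cases h : k < i ∧ i ≤ k + n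
        · rw [put_in h]
        · rw [put_out (by omega), hb i (by omega)]
      rw [this]
      exact ⟨fun h => h.1, fun h => ⟨h, k, n, hb⟩⟩)
    (fun b hb => hb.2)
  exact ⟨x, Subtype.ext h1⟩

theorem backward 
    (hΛ : {a // a ∈ S₁.carrier} → {b // b ∈ S₂.carrier})
    (φ : ↥(GLset (canonicalLGBS S₁)) → ↥(GLset (canonicalLGBS S₂)))
    (h : Config (canonicalLGBS S₁) → Config (canonicalLGBS S₂))
    (H1 : @IsHomeomorph _ _ (subTop S₁) (subTop S₂) hΛ)
    (H2 : @IsHomeomorph _ _ (GLtop (canonicalLGBS S₁)) (GLtop (canonicalLGBS S₂)) φ)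
    (H3 : ∀ g, (φ g).val.2.1 = g.val.2.1)
    (H4 : ∀ (x : Config (canonicalLGBS S₁)) (hx : (x, (0 : ℤ), x) ∈ GLset (canonicalLGBS S₁)),
        (φ ⟨(x, 0, x), hx⟩).val = (h x, 0, h x))
    (H5 : ∀ g g' gg : ↥(GLset (canonicalLGBS S₁)), g.val.2.2 = g'.val.1 →
        gg.val = (g.val.1, g.val.2.1 + g'.val.2.1, g'.val.2.2) →
        (φ gg).val = ((φ g).val.1, (φ g).val.2.1 + (φ g').val.2.1, (φ g').val.2.2))
    (H8 : ∀ x : Config (canonicalLGBS S₁), ∃ hx : configSeq x ∈ S₁.carrier,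
        (hΛ ⟨configSeq x, hx⟩).val = configSeq (h x)) : Nonempty (Conjugacy S₁ S₂) := by
  have hs : ∀ x, seqS (h x) = hΛ (seqS x) := by
    intro x
    obtain ⟨_, e⟩ := H8 x
    exact Subtype.ext e.symm
  have hu : ∀ x : Config (canonicalLGBS S₁), (x, (0 : ℤ), x) ∈ GLset (canonicalLGBS S₁) := by
    intro x
    show (shiftBy _ 0 x, x) ∈ Rset _
    rw [shift_zero]; exact rel_refl x
  have hφ1 : ∀ g, (φ g).val.1 = h g.val.1 := by
    intro g
    have := H5 ⟨_, hu g.val.1⟩ g g rfl (by simp)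
    rw [H4] at this
    exact congrArg (fun t => t.1) this
  have hφ2 : ∀ g, (φ g).val.2.2 = h g.val.2.2 := by
    intro g
    have := H5 g ⟨_, hu g.val.2.2⟩ g rfl (by simp)
    rw [H4] at this
    exact congrArg (fun t => t.2.2) this
  have : CompactSpace (Config (canonicalLGBS S₁)) := config_compact S₁
  have : CompactSpace (Config (canonicalLGBS S₂)) := config_compact S₂
  have c1 : @IsHomeomorph _ _ (subTop S₁) (subTop S₂) hΛ := H1
  obtain ⟨cΛ, HΛ, l1, r1, cH⟩ : @Continuous _ _ (subTop S₁) (subTop S₂) hΛ ∧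
      ∃ H : {b // b ∈ S₂.carrier} → {a // a ∈ S₁.carrier}, Function.LeftInverse H hΛ ∧
        Function.RightInverse H hΛ ∧ @Continuous _ _ (subTop S₂) (subTop S₁) H := by
    let _ := subTop S₁
    let _ := subTop S₂
    exact isHomeomorph_iff_exists_inverse.1 H1
  obtain ⟨cφ, ψ, l2, r2, cψ⟩ : @Continuous _ _ (GLtop (canonicalLGBS S₁)) (GLtop (canonicalLGBS S₂)) φ ∧
      ∃ H : ↥(GLset (canonicalLGBS S₂)) → ↥(GLset (canonicalLGBS S₁)), Function.LeftInverse H φ ∧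
        Function.RightInverse H φ ∧
        @Continuous _ _ (GLtop (canonicalLGBS S₂)) (GLtop (canonicalLGBS S₁)) H := by
    let _ := GLtop (canonicalLGBS S₁)
    let _ := GLtop (canonicalLGBS S₂)
    exact isHomeomorph_iff_exists_inverse.1 H2
  obtain ⟨N, hN⟩ := uniform_R (fun x => (GLmap (canonicalLGBS S₂) (φ (gen S₁ x))).1)
    (by
      let _ := GLtop (canonicalLGBS S₁)
      let _ := GLtop (canonicalLGBS S₂)
      let _ := indTop (canonicalLGBS S₂)
      exact (GLmap_cont S₂).comp (cφ.comp (gen_cont S₁)))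
  obtain ⟨M, hM⟩ := uniform_R (fun x => (GLmap (canonicalLGBS S₁) (ψ (gen S₂ x))).1)
    (by
      let _ := GLtop (canonicalLGBS S₁)
      let _ := GLtop (canonicalLGBS S₂)
      let _ := indTop (canonicalLGBS S₁)
      exact (GLmap_cont S₁).comp (cψ.comp (gen_cont S₂)))
  refine conj_of_eventual hΛ HΛ l1 r1 cΛ cH N M ?_ ?_
  · intro a i hi
    obtain ⟨x, rfl⟩ := exists_preimage S₁ a
    have e := hN x i hi
    change configSeq (shiftBy _ (φ (gen S₁ x)).val.2.1 (φ (gen S₁ x)).val.1) i =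
      configSeq (φ (gen S₁ x)).val.2.2 i at e
    rw [hφ1, hφ2, H3, seq_shift] at e
    change (seqS (h x)).val (i + 1) = (seqS (h (shiftBy _ 1 x))).val i at e
    rw [hs, hs] at e
    exact e.symm
  · intro b i hi
    obtain ⟨y, rfl⟩ := exists_preimage S₂ b
    have e := hM y i hi
    change configSeq (shiftBy _ (ψ (gen S₂ y)).val.2.1 (ψ (gen S₂ y)).val.1) i =
      configSeq (ψ (gen S₂ y)).val.2.2 i at e
    have d1 := hφ1 (ψ (gen S₂ y))
    have d2 := hφ2 (ψ (gen S₂ y))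
    have d3 := H3 (ψ (gen S₂ y))
    rw [r2] at d1 d2 d3
    rw [← d3, seq_shift] at e
    change (seqS (ψ (gen S₂ y)).val.1).val (i + 1) = (seqS (ψ (gen S₂ y)).val.2.2).val i at e
    have f1 : seqS (ψ (gen S₂ y)).val.1 = HΛ (seqS y) := by
      rw [← l1 (seqS _), ← hs, ← d1]; rfl
    have f2 : seqS (ψ (gen S₂ y)).val.2.2 = HΛ (shS S₂ 1 (seqS y)) := by
      rw [← l1 (seqS _), ← hs, ← d2]; rfl
    rw [f1, f2] at e
    exact e.symm

end GI


/-- Two subshifts `Λ₁, Λ₂` are topologically conjugate if and only if there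
are an isomorphism `φ : G_{Λ₁} → G_{Λ₂}` of the étale groupoids and a homeomorphism
`h_Λ : Λ₁ → Λ₂` with `φ(R_{Λ₁}) = R_{Λ₂}`, `h_Λ ∘ π₁ = π₂ ∘ h` (where `h` is the
restriction of `φ` to the unit spaces), and `d_{Λ₂} ∘ φ = d_{Λ₁}`. -/
theorem conjugate_iff_groupoid_isomorphism {A₁ A₂ : Type} [Fintype A₁] [Fintype A₂]
    (S₁ : Subshift A₁) (S₂ : Subshift A₂) :
    Nonempty (Conjugacy S₁ S₂) ↔
    ∃ (hΛ : {a // a ∈ S₁.carrier} → {b // b ∈ S₂.carrier})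
      (φ : ↥(GLset (canonicalLGBS S₁)) → ↥(GLset (canonicalLGBS S₂)))
      (h : Config (canonicalLGBS S₁) → Config (canonicalLGBS S₂)),
      -- `h_Λ` is a homeomorphism of the shift spaces
      @IsHomeomorph _ _ (subTop S₁) (subTop S₂) hΛ ∧
      -- `φ` is a homeomorphism of the groupoids
      @IsHomeomorph _ _ (GLtop (canonicalLGBS S₁)) (GLtop (canonicalLGBS S₂)) φ ∧
      -- `φ` preserves the degree maps: `d_{Λ₂} ∘ φ = d_{Λ₁}`
      (∀ g, (φ g).val.2.1 = g.val.2.1) ∧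
      -- `h` is the restriction of `φ` to the unit spaces
      (∀ (x : Config (canonicalLGBS S₁)) (hx : (x, (0 : ℤ), x) ∈ GLset (canonicalLGBS S₁)),
        (φ ⟨(x, 0, x), hx⟩).val = (h x, 0, h x)) ∧
      -- `φ` is multiplicative on composable pairs
      (∀ g g' gg : ↥(GLset (canonicalLGBS S₁)), g.val.2.2 = g'.val.1 →
        gg.val = (g.val.1, g.val.2.1 + g'.val.2.1, g'.val.2.2) →
        (φ gg).val = ((φ g).val.1, (φ g).val.2.1 + (φ g').val.2.1, (φ g').val.2.2)) ∧
      -- `φ` maps the embedded `R_{Λ₁}` onto the embedded `R_{Λ₂}`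
      (φ '' {g | g.val.2.1 = 0} = {g | g.val.2.1 = 0}) ∧
      -- `φ` maps the unit space onto the unit space
      (φ '' {g | g.val.2.1 = 0 ∧ g.val.1 = g.val.2.2} =
        {g | g.val.2.1 = 0 ∧ g.val.1 = g.val.2.2}) ∧
      -- `h_Λ ∘ π₁ = π₂ ∘ h`
      (∀ x : Config (canonicalLGBS S₁), ∃ hx : configSeq x ∈ S₁.carrier,
        (hΛ ⟨configSeq x, hx⟩).val = configSeq (h x)) := by
  constructor
  · rintro ⟨c⟩
    exact GI.forward c
  · rintro ⟨hΛ, φ, h, H1, H2, H3, H4, H5, _, _, H8⟩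
    exact GI.backward hΛ φ h H1 H2 H3 H4 H5 H8
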